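/- arXiv:1106.0912 — 2 statements merged into one kernel-verified Lean document; each statement's English description precedes it below -/
import Mathlib

section
/- (Sub-coercivity for H.) There exist universal constants c > 0 and C > 0 such that for every u ∈ C²((0,∞)) satisfying ∫ u²/(y⁴(1+|log y|)²) + ∫ |(Au)'|² + ∫ (Au)²/(y²(1+y²)) < ∞ (all integrals with respect to y dy on (0,∞)): (i) c·[ ∫ |(Au)'|² + ∫ (Au)²/(y²(1+y²)) ] ≤ ∫ (Hu)² ≤ C·[ ∫ |(Au)'|² + ∫ (Au)²/(y²(1+y²)) ]; (ii) ∫ (Hu)² ≥ c·[ ∫ (u'')²/(1+|log y|)² + ∫ (u')²/(y²(1+|log y|)²) + ∫ u²/(y⁴(1+|log y|)²) ] − C·∫ u²/(1+y⁵). -/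
open MeasureTheory Real Set

noncomputable section

/-- `Z(y) = (1-y²)/(1+y²)`. -/
def Zfun (y : ℝ) : ℝ := (1 - y ^ 2) / (1 + y ^ 2)

/-- `V(y) = (y⁴-6y²+1)/(1+y²)²`. -/
def Vfun (y : ℝ) : ℝ := (y ^ 4 - 6 * y ^ 2 + 1) / (1 + y ^ 2) ^ 2

/-- `Au = -u' + (Z/y) u`. -/
def Aop (u : ℝ → ℝ) (y : ℝ) : ℝ := -(deriv u y) + Zfun y / y * u y

/-- The linearized Hamiltonian `Hu = -u'' - u'/y + (V/y²) u`. -/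
def Hop (u : ℝ → ℝ) (y : ℝ) : ℝ :=
  -(deriv (deriv u) y) - deriv u y / y + Vfun y / y ^ 2 * u y

/-- If `f` is integrable then `y f(y)` takes arbitrarily small values near the origin. -/
lemma exists_small_mul_lt_near_zero {f : ℝ → ℝ} (hf : IntegrableOn f (Ioi 0)) {ε δ : ℝ}
    (hε : 0 < ε) (hδ : 0 < δ) : ∃ a, 0 < a ∧ a < δ ∧ a * f a < ε := by
  by_contra! h
  have h1 : IntegrableOn (fun y : ℝ => y⁻¹) (Ioo 0 δ) := by
    have h2 : IntegrableOn (fun y => ε⁻¹ * f y) (Ioo 0 δ) :=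
      (hf.mono_set Ioo_subset_Ioi_self).const_mul _
    refine Integrable.mono' h2 measurable_inv.aestronglyMeasurable ?_
    refine (ae_restrict_mem measurableSet_Ioo).mono fun y hy => ?_
    have h3 := h y hy.1 hy.2
    have hy0 : 0 < y := hy.1
    rw [Real.norm_of_nonneg (by positivity), inv_mul_eq_div, le_div_iff₀ hε, inv_mul_eq_div,
      div_le_iff₀ hy0]
    linarith
  have h2 : IntegrableOn (fun y : ℝ => y ^ (-1 : ℝ)) (Ioo 0 δ) := by
    simpa only [Real.rpow_neg_one] using h1
  rw [intervalIntegral.integrableOn_Ioo_rpow_iff hδ] at h2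
  exact lt_irrefl _ h2

/-- If `f` is integrable then `y f(y)` takes arbitrarily small values near infinity. -/
lemma exists_large_mul_lt {f : ℝ → ℝ} (hf : IntegrableOn f (Ioi 0)) {ε R : ℝ}
    (hε : 0 < ε) (hR : 0 < R) : ∃ b, R < b ∧ b * f b < ε := by
  by_contra! h
  refine not_integrableOn_Ioi_inv (a := R) ?_
  have h2 : IntegrableOn (fun y => ε⁻¹ * f y) (Ioi R) :=
    (hf.mono_set (Ioi_subset_Ioi hR.le)).const_mul _
  refine Integrable.mono' h2 measurable_inv.aestronglyMeasurable ?_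
  refine (ae_restrict_mem measurableSet_Ioi).mono fun y hy => ?_
  have h3 := h y hy
  have hy0 : 0 < y := hR.trans hy
  rw [Real.norm_of_nonneg (by positivity), inv_mul_eq_div, le_div_iff₀ hε, inv_mul_eq_div,
    div_le_iff₀ hy0]
  linarith

/-- If `p` and `h` are nonnegative, `p` is at most `h` plus the derivative of `F`, and the boundary
values of `F` have the favourable sign up to terms `y f(y)` with `f` integrable, then
`∫ p ≤ ∫ h`. -/
lemma integrableOn_and_integral_le_of_le_add_deriv {p h F F' f₀ f₁ : ℝ → ℝ}
    (hp : ContinuousOn p (Ioi 0)) (hp0 : ∀ y, 0 < y → 0 ≤ p y)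
    (hh : IntegrableOn h (Ioi 0)) (hh0 : ∀ y, 0 < y → 0 ≤ h y)
    (hF : ∀ y, 0 < y → HasDerivAt F (F' y) y)
    (hle : ∀ y, 0 < y → p y ≤ h y + F' y)
    (hf₀ : IntegrableOn f₀ (Ioi 0)) (hF₀ : ∀ y, 0 < y → y ≤ 1 → -F y ≤ y * f₀ y)
    (hf₁ : IntegrableOn f₁ (Ioi 0)) (hF₁ : ∀ y, 1 ≤ y → F y ≤ y * f₁ y) :
    IntegrableOn p (Ioi 0) ∧ ∫ y in Ioi (0:ℝ), p y ≤ ∫ y in Ioi (0:ℝ), h y := by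
  have hpI : ∀ a b : ℝ, 0 < a → IntegrableOn p (Icc a b) := fun a b ha =>
    (hp.mono fun y hy => lt_of_lt_of_le ha hy.1).integrableOn_Icc
  have key : ∀ a b : ℝ, 0 < a → ∫ y in Icc a b, p y ≤ ∫ y in Ioi (0:ℝ), h y := by
    intro a b ha
    refine le_of_forall_pos_le_add fun ε hε => ?_
    obtain ⟨a', ha'0, ha', hfa⟩ := exists_small_mul_lt_near_zero hf₀ (half_pos hε)
      (lt_min ha one_pos)
    obtain ⟨b', hb', hfb⟩ := exists_large_mul_lt hf₁ (half_pos hε)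
      (lt_of_lt_of_le one_pos (le_max_right b 1))
    have ha1 : a' < a := ha'.trans_le (min_le_left _ _)
    have ha2 : a' < 1 := ha'.trans_le (min_le_right _ _)
    have hb1 : b < b' := (le_max_left _ _).trans_lt hb'
    have hb2 : 1 < b' := (le_max_right _ _).trans_lt hb'
    have hab : a' ≤ b' := (ha2.trans hb2).le
    have hhI : IntegrableOn h (Icc a' b') := hh.mono_set fun y hy => ha'0.trans_le hy.1
    have hFTC := intervalIntegral.sub_le_integral_of_hasDeriv_right_of_le (g := fun y => -F y)
      (g' := fun y => -F' y) (φ := fun y => h y - p y) hab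
      (fun y hy => ((hF y (ha'0.trans_le hy.1)).neg).continuousAt.continuousWithinAt)
      (fun y hy => ((hF y (ha'0.trans hy.1)).neg).hasDerivWithinAt)
      (hhI.sub (hpI a' b' ha'0))
      (fun y hy => by have := hle y (ha'0.trans hy.1); linarith)
    rw [intervalIntegral.integral_of_le hab, ← integral_Icc_eq_integral_Ioc,
      integral_sub hhI (hpI a' b' ha'0)] at hFTC
    have h1 : ∫ y in Icc a b, p y ≤ ∫ y in Icc a' b', p y :=
      setIntegral_mono_set (hpI a' b' ha'0)
        ((ae_restrict_mem measurableSet_Icc).mono fun y hy => hp0 y (ha'0.trans_le hy.1))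
        (LE.le.eventuallyLE (Icc_subset_Icc ha1.le hb1.le))
    have h2 : ∫ y in Icc a' b', h y ≤ ∫ y in Ioi (0:ℝ), h y :=
      setIntegral_mono_set hh ((ae_restrict_mem measurableSet_Ioi).mono fun y hy => hh0 y hy)
        (LE.le.eventuallyLE fun y hy => ha'0.trans_le hy.1)
    have h3 := hF₀ a' ha'0 ha2.le
    have h4 := hF₁ b' hb2.le
    linarith
  let α : ℕ → ℝ := fun n => 1 / ((n : ℝ) + 1)
  have hα : Filter.Tendsto α Filter.atTop (nhds 0) := tendsto_one_div_add_atTop_nhds_zero_nat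
  have hαpos : ∀ n, 0 < α n := fun n => by positivity
  have cover : AECover (volume.restrict (Ioi (0:ℝ))) Filter.atTop
      fun n : ℕ => Icc (α n) (n : ℝ) :=
    (aecover_Ioi_of_Ici hα).inter (aecover_Iic tendsto_natCast_atTop_atTop)
  have hres : ∀ n : ℕ, (volume.restrict (Ioi (0:ℝ))).restrict (Icc (α n) (n : ℝ))
      = volume.restrict (Icc (α n) (n : ℝ)) := fun n => by
    rw [Measure.restrict_restrict measurableSet_Icc, inter_eq_left.mpr]
    exact fun y hy => (hαpos n).trans_le hy.1
  have hbound : ∀ n : ℕ, ∫ y in Icc (α n) (n : ℝ), p y ∂(volume.restrict (Ioi (0:ℝ)))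
      ≤ ∫ y in Ioi (0:ℝ), h y := fun n => by
    rw [hres]; exact key _ _ (hαpos n)
  have hint : IntegrableOn p (Ioi 0) :=
    cover.integrable_of_integral_bounded_of_nonneg_ae _
      (fun n => by rw [IntegrableOn, hres]; exact hpI _ _ (hαpos n))
      ((ae_restrict_mem measurableSet_Ioi).mono fun y hy => hp0 y hy)
      (Filter.Eventually.of_forall hbound)
  exact ⟨hint, le_of_tendsto' (cover.integral_tendsto_of_countably_generated hint) hbound⟩

/-- Smooth substitute for `1 + |log y|` at infinity. -/
def logInfty (y : ℝ) : ℝ := 1 + Real.log (1 + y ^ 2)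

/-- Smooth substitute for `1 + |log y|` at the origin. -/
def logZero (y : ℝ) : ℝ := 1 + Real.log (1 + y ^ 2) - 2 * Real.log y

lemma one_le_logInfty (y : ℝ) : 1 ≤ logInfty y := by
  have := Real.log_nonneg (show (1:ℝ) ≤ 1 + y ^ 2 by nlinarith [sq_nonneg y])
  unfold logInfty; linarith

lemma one_le_logZero {y : ℝ} (hy : 0 < y) : 1 ≤ logZero y := by
  have h := Real.log_le_log (by positivity : (0:ℝ) < y ^ 2) (by linarith : y ^ 2 ≤ 1 + y ^ 2)
  rw [Real.log_pow] at h
  push_cast at h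
  unfold logZero; linarith

lemma hasDerivAt_one_add_sq (y : ℝ) : HasDerivAt (fun x : ℝ => 1 + x ^ 2) (2 * y) y := by
  simpa using (hasDerivAt_pow 2 y).const_add 1

lemma hasDerivAt_logInfty (y : ℝ) : HasDerivAt logInfty (2 * y / (1 + y ^ 2)) y :=
  ((hasDerivAt_one_add_sq y).log (by positivity)).const_add 1

lemma hasDerivAt_logZero {y : ℝ} (hy : 0 < y) :
    HasDerivAt logZero (2 * y / (1 + y ^ 2) - 2 * y⁻¹) y :=
  (hasDerivAt_logInfty y).sub ((Real.hasDerivAt_log hy.ne').const_mul 2)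

lemma log_one_add_sq_le {y : ℝ} (hy : 0 < y) :
    Real.log (1 + y ^ 2) ≤ 1 + Real.log y + |Real.log y| := by
  rcases le_total y 1 with h | h
  · rw [abs_of_nonpos (Real.log_nonpos hy.le h)]
    have := Real.log_le_sub_one_of_pos (show (0:ℝ) < 1 + y ^ 2 by positivity)
    nlinarith
  · rw [abs_of_nonneg (Real.log_nonneg h)]
    have h1 := Real.log_le_sub_one_of_pos (show (0:ℝ) < (1 + y ^ 2) / y ^ 2 by positivity)
    rw [Real.log_div (by positivity) (by positivity), Real.log_pow] at h1
    have h2 : (1 + y ^ 2) / y ^ 2 ≤ 2 := by rw [div_le_iff₀ (by positivity)]; nlinarith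
    push_cast at h1
    linarith

lemma logInfty_le {y : ℝ} (hy : 0 < y) : logInfty y ≤ 2 * (1 + |Real.log y|) := by
  have := log_one_add_sq_le hy
  have := le_abs_self (Real.log y)
  unfold logInfty; linarith

lemma logZero_le {y : ℝ} (hy : 0 < y) : logZero y ≤ 2 * (1 + |Real.log y|) := by
  have := log_one_add_sq_le hy
  have := neg_abs_le (Real.log y)
  unfold logZero; linarith

lemma sq_one_add_abs_log_le {y : ℝ} (hy : 0 < y) :
    (1 + |Real.log y|) ^ 2 ≤ 4 * (y + 1 / y) := by
  set s := √y with hs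
  have hs0 : 0 < s := Real.sqrt_pos.mpr hy
  have hsy : y = s ^ 2 := (Real.sq_sqrt hy.le).symm
  have hlog : Real.log y = 2 * Real.log s := by rw [hsy, Real.log_pow]; push_cast; ring
  have h1 := Real.log_le_sub_one_of_pos hs0
  have h2 := Real.log_le_sub_one_of_pos (inv_pos.mpr hs0)
  rw [Real.log_inv] at h2
  have hi : 1 / y = s⁻¹ ^ 2 := by rw [hsy]; simp
  have hsi : 0 < s⁻¹ := inv_pos.mpr hs0
  rw [hlog, hi, hsy]
  rcases le_total 0 (Real.log s) with h | h
  · rw [abs_of_nonneg (by linarith)]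
    nlinarith [sq_nonneg s⁻¹]
  · rw [abs_of_nonpos (by linarith)]
    nlinarith [sq_nonneg s]

lemma continuousOn_logInfty (s : Set ℝ) : ContinuousOn logInfty s := fun y _ =>
  (hasDerivAt_logInfty y).continuousAt.continuousWithinAt

lemma continuousOn_logZero : ContinuousOn logZero (Ioi 0) := fun _ hy =>
  (hasDerivAt_logZero hy).continuousAt.continuousWithinAt

lemma continuousOn_of_forall_hasDerivAt {f f' : ℝ → ℝ}
    (hf : ∀ y, 0 < y → HasDerivAt f (f' y) y) : ContinuousOn f (Ioi 0) :=
  fun y hy => (hf y hy).continuousAt.continuousWithinAt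

/-- The factorized energy identity: the cross term of the square of `w₁ + 2 / (y (1 + y²)) w` is a
total derivative up to a positive potential. -/
lemma integral_sq_add_eq {w w₁ : ℝ → ℝ} (hw : ∀ y, 0 < y → HasDerivAt w (w₁ y) y)
    (hw₁ : ContinuousOn w₁ (Ioi 0))
    (h1 : IntegrableOn (fun y => w₁ y ^ 2 * y) (Ioi 0))
    (h2 : IntegrableOn (fun y => w y ^ 2 / (y ^ 2 * (1 + y ^ 2)) * y) (Ioi 0)) :
    ∫ y in Ioi (0:ℝ), (w₁ y + 2 / (y * (1 + y ^ 2)) * w y) ^ 2 * y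
      = (∫ y in Ioi (0:ℝ), w₁ y ^ 2 * y)
        + 4 * ∫ y in Ioi (0:ℝ), w y ^ 2 / (y ^ 2 * (1 + y ^ 2)) * y := by
  have hwc := continuousOn_of_forall_hasDerivAt hw
  have hcont : ContinuousOn (fun y => (w₁ y + 2 / (y * (1 + y ^ 2)) * w y) ^ 2 * y) (Ioi 0) := by
    refine ContinuousOn.mul (ContinuousOn.pow (hw₁.add (ContinuousOn.mul ?_ hwc)) 2) continuousOn_id
    refine continuousOn_const.div (by fun_prop) fun y hy => ?_
    have : 0 < y := hy
    positivity
  have hcont' : ContinuousOn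
      (fun y => w₁ y ^ 2 * y + 4 * (w y ^ 2 / (y ^ 2 * (1 + y ^ 2)) * y)) (Ioi 0) := by
    refine ((hw₁.pow 2).mul continuousOn_id).add (continuousOn_const.mul
      (ContinuousOn.mul ((hwc.pow 2).div (by fun_prop) fun y hy => ?_) continuousOn_id))
    have : 0 < y := hy
    positivity
  have hF : ∀ y, 0 < y → HasDerivAt (fun y => 2 * w y ^ 2 / (1 + y ^ 2))
      ((w₁ y + 2 / (y * (1 + y ^ 2)) * w y) ^ 2 * y
        - (w₁ y ^ 2 * y + 4 * (w y ^ 2 / (y ^ 2 * (1 + y ^ 2)) * y))) y := by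
    intro y hy
    refine HasDerivAt.congr_deriv (((((hw y hy).pow 2).const_mul 2).div (hasDerivAt_one_add_sq y)
      (by positivity))) ?_
    simp only [Pi.pow_apply]
    push_cast
    field_simp
    ring
  have hh := h1.add (h2.const_mul 4)
  have hf := h2.const_mul 2
  have hp0 : ∀ y : ℝ, 0 < y → 0 ≤ (w₁ y + 2 / (y * (1 + y ^ 2)) * w y) ^ 2 * y :=
    fun y hy => by positivity
  have hh0 : ∀ y : ℝ, 0 < y → 0 ≤ w₁ y ^ 2 * y + 4 * (w y ^ 2 / (y ^ 2 * (1 + y ^ 2)) * y) :=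
    fun y hy => by positivity
  have hFf : ∀ y : ℝ, 0 < y → 2 * w y ^ 2 / (1 + y ^ 2)
      = y * (2 * (w y ^ 2 / (y ^ 2 * (1 + y ^ 2)) * y)) := fun y hy => by field_simp
  have hF0 : ∀ y : ℝ, 0 < y → 0 ≤ 2 * w y ^ 2 / (1 + y ^ 2) := fun y hy => by positivity
  have A := integrableOn_and_integral_le_of_le_add_deriv hcont hp0 hh hh0 hF
    (fun y hy => by simp only [Pi.add_apply]; linarith) hf
    (fun y hy _ => by rw [← hFf y hy]; linarith [hF0 y hy]) hf
    (fun y hy => (hFf y (by linarith)).le)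
  have B := integrableOn_and_integral_le_of_le_add_deriv hcont' hh0 A.1 hp0
    (fun y hy => (hF y hy).neg) (fun y hy => by linarith) hf
    (fun y hy _ => by rw [← hFf y hy, Pi.neg_apply, neg_neg]) hf
    (fun y hy => by
      rw [← hFf y (by linarith), Pi.neg_apply]; linarith [hF0 y (by linarith)])
  rw [← integral_const_mul, ← integral_add h1 (h2.const_mul 4)]
  exact le_antisymm A.2 B.2

/-- Logarithmic Hardy inequality for `w`. -/
lemma integral_sq_div_log_le {w w₁ : ℝ → ℝ} (hw : ∀ y, 0 < y → HasDerivAt w (w₁ y) y)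
    (h1 : IntegrableOn (fun y => w₁ y ^ 2 * y) (Ioi 0))
    (h2 : IntegrableOn (fun y => w y ^ 2 / (y ^ 2 * (1 + y ^ 2)) * y) (Ioi 0)) :
    IntegrableOn (fun y => w y ^ 2 / (y * logInfty y ^ 2)) (Ioi 0) ∧
    ∫ y in Ioi (0:ℝ), w y ^ 2 / (y * logInfty y ^ 2)
      ≤ (∫ y in Ioi (0:ℝ), w₁ y ^ 2 * y)
        + 2 * ∫ y in Ioi (0:ℝ), w y ^ 2 / (y ^ 2 * (1 + y ^ 2)) * y := by
  have hL : ∀ y, 0 < logInfty y := fun y => by linarith [one_le_logInfty y]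
  have hF : ∀ y, 0 < y → HasDerivAt (fun y => -(w y ^ 2 / logInfty y))
      (-((2 * w y * w₁ y * logInfty y - w y ^ 2 * (2 * y / (1 + y ^ 2))) / logInfty y ^ 2)) y := by
    intro y hy
    refine HasDerivAt.congr_deriv ((((hw y hy).pow 2).div (hasDerivAt_logInfty y) (hL y).ne').neg) ?_
    simp only [Pi.pow_apply]
    push_cast
    ring
  rw [← integral_const_mul, ← integral_add h1 (h2.const_mul 2)]
  refine integrableOn_and_integral_le_of_le_add_deriv ?_ (fun y hy => by positivity)
    (h1.add (h2.const_mul 2)) (fun y hy => by positivity) hF ?_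
    (h2.const_mul 2) ?_ (integrable_zero ℝ ℝ _) ?_
  · refine ((continuousOn_of_forall_hasDerivAt hw).pow 2).div
      (continuousOn_id.mul ((continuousOn_logInfty _).pow 2)) fun y hy => ?_
    have : 0 < y := hy
    have := hL y
    positivity
  · intro y hy
    have hl := hL y
    have hl1 : 1 / logInfty y ^ 2 ≤ 1 := by
      rw [div_le_one (by positivity)]; nlinarith [one_le_logInfty y]
    have key : (w₁ y ^ 2 * y + 2 * (w y ^ 2 / (y ^ 2 * (1 + y ^ 2)) * y))
        + (-((2 * w y * w₁ y * logInfty y - w y ^ 2 * (2 * y / (1 + y ^ 2))) / logInfty y ^ 2))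
        - w y ^ 2 / (y * logInfty y ^ 2)
        = y * (w₁ y - w y / (y * logInfty y)) ^ 2
          + 2 * w y ^ 2 / (y * (1 + y ^ 2)) * (1 - 1 / logInfty y ^ 2) := by
      field_simp
      ring
    have : 0 ≤ y * (w₁ y - w y / (y * logInfty y)) ^ 2
          + 2 * w y ^ 2 / (y * (1 + y ^ 2)) * (1 - 1 / logInfty y ^ 2) :=
      add_nonneg (by positivity) (mul_nonneg (by positivity) (by linarith))
    linarith
  · intro y hy hy1
    rw [neg_neg]
    have h3 : w y ^ 2 / logInfty y ≤ w y ^ 2 := div_le_self (sq_nonneg _) (one_le_logInfty y)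
    have h4 : w y ^ 2 ≤ y * (2 * (w y ^ 2 / (y ^ 2 * (1 + y ^ 2)) * y)) := by
      have : y * (2 * (w y ^ 2 / (y ^ 2 * (1 + y ^ 2)) * y)) = 2 * w y ^ 2 / (1 + y ^ 2) := by
        field_simp
      rw [this, le_div_iff₀ (by positivity)]
      nlinarith [mul_nonneg (sq_nonneg (w y)) (show 0 ≤ 1 - y ^ 2 by nlinarith)]
    exact h3.trans h4
  · intro y hy
    have := hL y
    rw [Pi.zero_apply, mul_zero, neg_nonpos]
    positivity

lemma one_add_pow_five_le {y : ℝ} (hy : 0 < y) : 1 + y ^ 5 ≤ 2 * (1 + y ^ 2) ^ 3 := by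
  rcases le_total y 1 with h | h
  · have : y ^ 5 ≤ 1 := pow_le_one₀ hy.le h
    have : 1 ≤ (1 + y ^ 2) ^ 3 := one_le_pow₀ (by nlinarith)
    linarith
  · have h1 : y ^ 5 ≤ y ^ 6 := pow_le_pow_right₀ h (by norm_num)
    nlinarith [sq_nonneg y, sq_nonneg (y ^ 2)]

lemma sq_mul_div_le {y : ℝ} (hy : 0 < y) (x : ℝ) :
    x ^ 2 * y / (1 + y ^ 2) ^ 3 ≤ 2 * (x ^ 2 / (1 + y ^ 5) * y) := by
  have h : 2 * (x ^ 2 / (1 + y ^ 5) * y) = 2 * (x ^ 2 * y) / (1 + y ^ 5) := by ring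
  rw [h, div_le_div_iff₀ (by positivity) (by positivity)]
  nlinarith [mul_le_mul_of_nonneg_left (one_add_pow_five_le hy)
    (show 0 ≤ x ^ 2 * y by positivity)]

/-- Control of `u` near the origin. -/
lemma integral_sq_div_logZero_le {u w : ℝ → ℝ}
    (hu : ∀ y, 0 < y → HasDerivAt u (Zfun y / y * u y - w y) y)
    (h2 : IntegrableOn (fun y => w y ^ 2 / (y ^ 2 * (1 + y ^ 2)) * y) (Ioi 0))
    (hK : IntegrableOn (fun y => u y ^ 2 / (1 + y ^ 5) * y) (Ioi 0)) :
    IntegrableOn (fun y => u y ^ 2 / (y ^ 3 * (1 + y ^ 2) ^ 3 * logZero y ^ 2)) (Ioi 0) ∧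
    ∫ y in Ioi (0:ℝ), u y ^ 2 / (y ^ 3 * (1 + y ^ 2) ^ 3 * logZero y ^ 2)
      ≤ 64 * (∫ y in Ioi (0:ℝ), u y ^ 2 / (1 + y ^ 5) * y)
        + 2 * ∫ y in Ioi (0:ℝ), w y ^ 2 / (y ^ 2 * (1 + y ^ 2)) * y := by
  have hL : ∀ y, 0 < y → 0 < logZero y := fun y hy => by linarith [one_le_logZero hy]
  have hF : ∀ y, 0 < y → HasDerivAt (fun y => u y ^ 2 / (y ^ 2 * (1 + y ^ 2) ^ 2 * logZero y))
      (2 * u y ^ 2 / (y ^ 3 * (1 + y ^ 2) ^ 3 * logZero y ^ 2)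
        - 8 * u y ^ 2 / (y * (1 + y ^ 2) ^ 3 * logZero y)
        - 2 * u y * w y / (y ^ 2 * (1 + y ^ 2) ^ 2 * logZero y)) y := by
    intro y hy
    have hl := hL y hy
    refine HasDerivAt.congr_deriv ((((hu y hy).pow 2).div (((hasDerivAt_pow 2 y).mul
      ((hasDerivAt_one_add_sq y).pow 2)).mul (hasDerivAt_logZero hy))
      (by positivity))) ?_
    simp only [Pi.mul_apply, Pi.pow_apply, Zfun]
    push_cast
    field_simp
    ring
  rw [← integral_const_mul, ← integral_const_mul,
    ← integral_add (hK.const_mul 64) (h2.const_mul 2)]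
  refine integrableOn_and_integral_le_of_le_add_deriv ?_
    (fun y hy => by positivity)
    ((hK.const_mul 64).add (h2.const_mul 2))
    (fun y hy => by positivity) hF ?_
    (integrable_zero ℝ ℝ _) ?_ (hK.const_mul 2) ?_
  · refine ((continuousOn_of_forall_hasDerivAt hu).pow 2).div
      (ContinuousOn.mul (by fun_prop) (continuousOn_logZero.pow 2)) fun y hy => ?_
    have : 0 < y := hy
    have := hL y hy
    positivity
  · intro y hy
    have hl := hL y hy
    have hk := sq_mul_div_le hy (u y)
    have key : (32 * (u y ^ 2 * y / (1 + y ^ 2) ^ 3) + 2 * (w y ^ 2 / (y ^ 2 * (1 + y ^ 2)) * y))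
        + (2 * u y ^ 2 / (y ^ 3 * (1 + y ^ 2) ^ 3 * logZero y ^ 2)
        - 8 * u y ^ 2 / (y * (1 + y ^ 2) ^ 3 * logZero y)
        - 2 * u y * w y / (y ^ 2 * (1 + y ^ 2) ^ 2 * logZero y))
        - u y ^ 2 / (y ^ 3 * (1 + y ^ 2) ^ 3 * logZero y ^ 2)
        = 1 / (2 * y ^ 3 * (1 + y ^ 2) ^ 3) * ((u y / logZero y - 8 * u y * y ^ 2) ^ 2
          + (u y / logZero y - 2 * w y * y * (1 + y ^ 2)) ^ 2) := by
      field_simp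
      ring
    have : 0 ≤ 1 / (2 * y ^ 3 * (1 + y ^ 2) ^ 3) * ((u y / logZero y - 8 * u y * y ^ 2) ^ 2
          + (u y / logZero y - 2 * w y * y * (1 + y ^ 2)) ^ 2) := by positivity
    linarith
  · intro y hy _
    have := hL y hy
    rw [Pi.zero_apply, mul_zero, neg_nonpos]
    positivity
  · intro y hy
    have hy0 : 0 < y := by linarith
    have hl := one_le_logZero hy0
    have hl0 := hL y hy0
    have e : y * (2 * (u y ^ 2 / (1 + y ^ 5) * y)) = u y ^ 2 * (2 * y ^ 2) / (1 + y ^ 5) := by ring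
    rw [e, div_le_div_iff₀ (by positivity) (by positivity), mul_assoc]
    refine mul_le_mul_of_nonneg_left ?_ (sq_nonneg _)
    have h5 : 1 + y ^ 5 ≤ 2 * y ^ 8 := by
      have := one_le_pow₀ hy (n := 8)
      have := pow_le_pow_right₀ hy (show 5 ≤ 8 by norm_num)
      linarith
    have h6 : 2 * y ^ 8 ≤ 2 * y ^ 2 * (y ^ 2 * (1 + y ^ 2) ^ 2) := by
      have : 0 ≤ 2 * y ^ 4 * (1 + 2 * y ^ 2) := by positivity
      nlinarith
    have h7 : 2 * y ^ 2 * (y ^ 2 * (1 + y ^ 2) ^ 2)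
        ≤ 2 * y ^ 2 * (y ^ 2 * (1 + y ^ 2) ^ 2 * logZero y) :=
      mul_le_mul_of_nonneg_left (le_mul_of_one_le_right (by positivity) hl) (by positivity)
    linarith

/-- Control of `u` at infinity. -/
lemma integral_sq_div_logInfty_le {u w : ℝ → ℝ}
    (hu : ∀ y, 0 < y → HasDerivAt u (Zfun y / y * u y - w y) y)
    (hP : IntegrableOn (fun y => w y ^ 2 / (y * logInfty y ^ 2)) (Ioi 0))
    (hK : IntegrableOn (fun y => u y ^ 2 / (1 + y ^ 5) * y) (Ioi 0)) :
    IntegrableOn (fun y => u y ^ 2 * y ^ 3 / ((1 + y ^ 2) ^ 3 * logInfty y ^ 2)) (Ioi 0) ∧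
    ∫ y in Ioi (0:ℝ), u y ^ 2 * y ^ 3 / ((1 + y ^ 2) ^ 3 * logInfty y ^ 2)
      ≤ 8 * (∫ y in Ioi (0:ℝ), u y ^ 2 / (1 + y ^ 5) * y)
        + ∫ y in Ioi (0:ℝ), w y ^ 2 / (y * logInfty y ^ 2) := by
  have hL : ∀ y, 0 < logInfty y := fun y => by linarith [one_le_logInfty y]
  have hF : ∀ y, 0 < y → HasDerivAt
      (fun y => -(u y ^ 2 * y ^ 2 / ((1 + y ^ 2) ^ 2 * logInfty y ^ 2)))
      (u y ^ 2 * y / ((1 + y ^ 2) ^ 3 * logInfty y ^ 2)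
          * (4 * y ^ 2 + 4 * y ^ 2 / logInfty y - 4)
        + 2 * u y * w y * y ^ 2 / ((1 + y ^ 2) ^ 2 * logInfty y ^ 2)) y := by
    intro y hy
    have hl := hL y
    refine HasDerivAt.congr_deriv (((((hu y hy).pow 2).mul (hasDerivAt_pow 2 y)).div
      (((hasDerivAt_one_add_sq y).pow 2).mul ((hasDerivAt_logInfty y).pow 2))
      (by simp only [Pi.mul_apply, Pi.pow_apply]; positivity)).neg) ?_
    simp only [Pi.mul_apply, Pi.pow_apply, Zfun]
    push_cast
    field_simp
    ring
  rw [← integral_const_mul, ← integral_add (hK.const_mul 8) hP]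
  refine integrableOn_and_integral_le_of_le_add_deriv ?_
    (fun y hy => by positivity)
    ((hK.const_mul 8).add hP)
    (fun y hy => by positivity) hF ?_
    (hK.const_mul 2) ?_ (integrable_zero ℝ ℝ _) ?_
  · refine (((continuousOn_of_forall_hasDerivAt hu).pow 2).mul (by fun_prop)).div
      (ContinuousOn.mul (by fun_prop) ((continuousOn_logInfty _).pow 2)) fun y hy => ?_
    have := hL y
    positivity
  · intro y hy
    have hl := hL y
    have hk := sq_mul_div_le hy (u y)
    have hl1 : 1 / logInfty y ^ 2 ≤ 1 := by
      rw [div_le_one (by positivity)]; nlinarith [one_le_logInfty y]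
    have key : (4 * (u y ^ 2 * y / (1 + y ^ 2) ^ 3) + w y ^ 2 / (y * logInfty y ^ 2))
        + (u y ^ 2 * y / ((1 + y ^ 2) ^ 3 * logInfty y ^ 2)
          * (4 * y ^ 2 + 4 * y ^ 2 / logInfty y - 4)
        + 2 * u y * w y * y ^ 2 / ((1 + y ^ 2) ^ 2 * logInfty y ^ 2))
        - u y ^ 2 * y ^ 3 / ((1 + y ^ 2) ^ 3 * logInfty y ^ 2)
        = u y ^ 2 * y ^ 3 / ((1 + y ^ 2) ^ 3 * logInfty y ^ 2) * (2 + 4 / logInfty y)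
          + y / ((1 + y ^ 2) ^ 3 * logInfty y ^ 2) * (u y * y + w y * (1 + y ^ 2)) ^ 2
          + w y ^ 2 / (y * (1 + y ^ 2) * logInfty y ^ 2)
          + 4 * (u y ^ 2 * y / (1 + y ^ 2) ^ 3) * (1 - 1 / logInfty y ^ 2) := by
      field_simp
      ring
    have : 0 ≤ u y ^ 2 * y ^ 3 / ((1 + y ^ 2) ^ 3 * logInfty y ^ 2) * (2 + 4 / logInfty y)
          + y / ((1 + y ^ 2) ^ 3 * logInfty y ^ 2) * (u y * y + w y * (1 + y ^ 2)) ^ 2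
          + w y ^ 2 / (y * (1 + y ^ 2) * logInfty y ^ 2)
          + 4 * (u y ^ 2 * y / (1 + y ^ 2) ^ 3) * (1 - 1 / logInfty y ^ 2) :=
      add_nonneg (by positivity) (mul_nonneg (by positivity) (by linarith))
    linarith
  · intro y hy hy1
    have hl := one_le_logInfty y
    have hl0 := hL y
    have e : y * (2 * (u y ^ 2 / (1 + y ^ 5) * y)) = u y ^ 2 * y ^ 2 * 2 / (1 + y ^ 5) := by ring
    rw [neg_neg, e, div_le_div_iff₀ (by positivity) (by positivity), mul_assoc (u y ^ 2 * y ^ 2)]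
    refine mul_le_mul_of_nonneg_left ?_ (by positivity)
    have h5 : y ^ 5 ≤ 1 := pow_le_one₀ hy.le hy1
    have h6 : 1 ≤ (1 + y ^ 2) ^ 2 * logInfty y ^ 2 :=
      one_le_mul_of_one_le_of_one_le (one_le_pow₀ (by nlinarith)) (one_le_pow₀ hl)
    linarith
  · intro y hy
    have := hL y
    rw [Pi.zero_apply, mul_zero, neg_nonpos]
    positivity

lemma abs_Zfun_le_one (y : ℝ) : |Zfun y| ≤ 1 := by
  have : 0 < 1 + y ^ 2 := by positivity
  rw [Zfun, abs_div, abs_of_pos this, div_le_one this, abs_le]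
  constructor <;> nlinarith [sq_nonneg y]

lemma hasDerivAt_Zfun_div {y : ℝ} (hy : 0 < y) :
    HasDerivAt (fun x => Zfun x / x) ((Zfun y ^ 2 - Zfun y - 1) / y ^ 2) y := by
  have h : HasDerivAt (fun x : ℝ => 1 - x ^ 2) (-(2 * y)) y := by
    simpa using (hasDerivAt_pow 2 y).const_sub 1
  refine HasDerivAt.congr_deriv ((h.div (hasDerivAt_one_add_sq y) (by positivity)).div
    (hasDerivAt_id y) hy.ne') ?_
  simp only [Pi.div_apply, Zfun]
  field_simp
  ring

lemma continuousOn_Zfun : ContinuousOn Zfun (Ioi 0) := by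
  unfold Zfun
  exact ContinuousOn.div (by fun_prop) (by fun_prop) fun y _ => by positivity

lemma sq_div_log_le_add {y : ℝ} (hy : 0 < y) (x : ℝ) :
    x ^ 2 / (y ^ 4 * (1 + |Real.log y|) ^ 2) * y
      ≤ 16 * (x ^ 2 / (y ^ 3 * (1 + y ^ 2) ^ 3 * logZero y ^ 2)
        + x ^ 2 * y ^ 3 / ((1 + y ^ 2) ^ 3 * logInfty y ^ 2)) := by
  set a := 1 + |Real.log y| with ha
  have ha0 : 0 < a := by positivity
  have h0 := one_le_logZero hy
  have h1 := one_le_logInfty y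
  have h2 : x ^ 2 / (y ^ 3 * (1 + y ^ 2) ^ 3 * (2 * a) ^ 2)
      ≤ x ^ 2 / (y ^ 3 * (1 + y ^ 2) ^ 3 * logZero y ^ 2) := by
    gcongr
    exact logZero_le hy
  have h3 : x ^ 2 * y ^ 3 / ((1 + y ^ 2) ^ 3 * (2 * a) ^ 2)
      ≤ x ^ 2 * y ^ 3 / ((1 + y ^ 2) ^ 3 * logInfty y ^ 2) := by
    gcongr
    exact logInfty_le hy
  have h4 : 16 * (x ^ 2 / (y ^ 3 * (1 + y ^ 2) ^ 3 * (2 * a) ^ 2)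
        + x ^ 2 * y ^ 3 / ((1 + y ^ 2) ^ 3 * (2 * a) ^ 2)) - x ^ 2 / (y ^ 4 * a ^ 2) * y
      = x ^ 2 * (3 * (1 + y ^ 2) * (1 - y ^ 2) ^ 2) / (y ^ 3 * (1 + y ^ 2) ^ 3 * a ^ 2) := by
    field_simp
    ring
  have h5 : 0 ≤ x ^ 2 * (3 * (1 + y ^ 2) * (1 - y ^ 2) ^ 2)
      / (y ^ 3 * (1 + y ^ 2) ^ 3 * a ^ 2) := by positivity
  linarith

lemma sq_div_le_sq_div_logInfty {y : ℝ} (hy : 0 < y) (x : ℝ) :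
    x ^ 2 / (y * (1 + |Real.log y|) ^ 2) ≤ 4 * (x ^ 2 / (y * logInfty y ^ 2)) := by
  have h1 := one_le_logInfty y
  have h2 : x ^ 2 / (y * (2 * (1 + |Real.log y|)) ^ 2) ≤ x ^ 2 / (y * logInfty y ^ 2) := by
    gcongr
    exact logInfty_le hy
  have h3 : x ^ 2 / (y * (2 * (1 + |Real.log y|)) ^ 2)
      = x ^ 2 / (y * (1 + |Real.log y|) ^ 2) / 4 := by
    field_simp
    ring
  linarith

lemma sq_div_one_add_pow_five_le {y : ℝ} (hy : 0 < y) (x : ℝ) :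
    x ^ 2 / (1 + y ^ 5) * y ≤ 8 * (x ^ 2 / (y ^ 4 * (1 + |Real.log y|) ^ 2) * y) := by
  have e : 8 * (x ^ 2 / (y ^ 4 * (1 + |Real.log y|) ^ 2) * y)
      = 8 * x ^ 2 / (y ^ 4 * (1 + |Real.log y|) ^ 2) * y := by ring
  rw [e]
  refine mul_le_mul_of_nonneg_right ?_ hy.le
  rw [div_le_div_iff₀ (by positivity) (by positivity)]
  have h1 : y ^ 4 * (1 + |Real.log y|) ^ 2 ≤ y ^ 4 * (4 * (y + 1 / y)) :=
    mul_le_mul_of_nonneg_left (sq_one_add_abs_log_le hy) (by positivity)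
  have h2 : y ^ 4 * (4 * (y + 1 / y)) = 4 * (y ^ 5 + y ^ 3) := by field_simp
  have h3 : y ^ 3 ≤ 1 + y ^ 5 := by
    rcases le_total y 1 with h | h
    · have := pow_le_one₀ hy.le h (n := 3)
      have : 0 < y ^ 5 := by positivity
      linarith
    · have := pow_le_pow_right₀ h (show 3 ≤ 5 by norm_num)
      linarith
  have h4 : y ^ 4 * (1 + |Real.log y|) ^ 2 ≤ 8 * (1 + y ^ 5) := by linarith
  nlinarith [mul_le_mul_of_nonneg_left h4 (sq_nonneg x)]

/-- Sub-coercivity for `H`: there exist universal `c, C > 0` such that for every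
`u ∈ C²((0,∞))` with finite `∫ u²/(y⁴(1+|log y|)²)`, `∫ |(Au)'|²` and
`∫ (Au)²/(y²(1+y²))` (all with respect to `y dy`):
(i) `∫ (Hu)² ≈ ∫ |(Au)'|² + ∫ (Au)²/(y²(1+y²))`;
(ii) `∫ (Hu)² ≥ c [∫ (u'')²/(1+|log y|)² + ∫ (u')²/(y²(1+|log y|)²)
      + ∫ u²/(y⁴(1+|log y|)²)] − C ∫ u²/(1+y⁵)`. -/
theorem subcoercivity_H :
    ∃ c C : ℝ, 0 < c ∧ 0 < C ∧
      ∀ u : ℝ → ℝ, ContDiffOn ℝ 2 u (Set.Ioi 0) →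
        IntegrableOn (fun y => (u y) ^ 2 / (y ^ 4 * (1 + |Real.log y|) ^ 2) * y)
          (Set.Ioi 0) →
        IntegrableOn (fun y => (deriv (Aop u) y) ^ 2 * y) (Set.Ioi 0) →
        IntegrableOn (fun y => (Aop u y) ^ 2 / (y ^ 2 * (1 + y ^ 2)) * y) (Set.Ioi 0) →
        (c * ((∫ y in Set.Ioi (0:ℝ), (deriv (Aop u) y) ^ 2 * y)
              + ∫ y in Set.Ioi (0:ℝ), (Aop u y) ^ 2 / (y ^ 2 * (1 + y ^ 2)) * y)
            ≤ ∫ y in Set.Ioi (0:ℝ), (Hop u y) ^ 2 * y) ∧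
        ((∫ y in Set.Ioi (0:ℝ), (Hop u y) ^ 2 * y)
            ≤ C * ((∫ y in Set.Ioi (0:ℝ), (deriv (Aop u) y) ^ 2 * y)
              + ∫ y in Set.Ioi (0:ℝ), (Aop u y) ^ 2 / (y ^ 2 * (1 + y ^ 2)) * y)) ∧
        ((∫ y in Set.Ioi (0:ℝ), (Hop u y) ^ 2 * y)
            ≥ c * ((∫ y in Set.Ioi (0:ℝ),
                  (deriv (deriv u) y) ^ 2 / (1 + |Real.log y|) ^ 2 * y)
                + (∫ y in Set.Ioi (0:ℝ),
                  (deriv u y) ^ 2 / (y ^ 2 * (1 + |Real.log y|) ^ 2) * y)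
                + ∫ y in Set.Ioi (0:ℝ),
                  (u y) ^ 2 / (y ^ 4 * (1 + |Real.log y|) ^ 2) * y)
              - C * ∫ y in Set.Ioi (0:ℝ), (u y) ^ 2 / (1 + y ^ 5) * y) := by
  refine ⟨1 / 1000, 100, by norm_num, by norm_num, fun u hu hU h1 h2 => ?_⟩
  have c1 : ContDiffOn ℝ 1 (deriv u) (Ioi 0) := hu.deriv_of_isOpen isOpen_Ioi (by norm_num)
  have c2 : ContinuousOn (deriv (deriv u)) (Ioi 0) :=
    (c1.deriv_of_isOpen (m := 0) isOpen_Ioi (by norm_num)).continuousOn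
  have hd1 : ∀ y, 0 < y → HasDerivAt u (deriv u y) y := fun y hy =>
    ((hu.differentiableOn (by norm_num)).differentiableAt (Ioi_mem_nhds hy)).hasDerivAt
  have hd2 : ∀ y, 0 < y → HasDerivAt (deriv u) (deriv (deriv u) y) y := fun y hy =>
    ((c1.differentiableOn (by norm_num)).differentiableAt (Ioi_mem_nhds hy)).hasDerivAt
  have hA : ∀ y, 0 < y → HasDerivAt (Aop u) (-(deriv (deriv u) y)
      + ((Zfun y ^ 2 - Zfun y - 1) / y ^ 2 * u y + Zfun y / y * deriv u y)) y := fun y hy =>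
    (hd2 y hy).neg.add ((hasDerivAt_Zfun_div hy).mul (hd1 y hy))
  have hdA : ∀ y, 0 < y → deriv (Aop u) y = -(deriv (deriv u) y)
      + ((Zfun y ^ 2 - Zfun y - 1) / y ^ 2 * u y + Zfun y / y * deriv u y) :=
    fun y hy => (hA y hy).deriv
  have hw : ∀ y, 0 < y → HasDerivAt (Aop u) (deriv (Aop u) y) y := fun y hy =>
    (hA y hy).differentiableAt.hasDerivAt
  have hw₁ : ContinuousOn (deriv (Aop u)) (Ioi 0) := by
    refine ContinuousOn.congr ?_ hdA
    have hZ := continuousOn_Zfun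
    exact c2.neg.add (((((hZ.pow 2).sub hZ).sub continuousOn_const).div (by fun_prop)
      (fun y hy => pow_ne_zero 2 (ne_of_gt hy)) |>.mul hu.continuousOn).add
      ((hZ.div continuousOn_id fun y hy => ne_of_gt hy).mul c1.continuousOn))
  have hu' : ∀ y, 0 < y → HasDerivAt u (Zfun y / y * u y - Aop u y) y := fun y hy =>
    (hd1 y hy).congr_deriv (by unfold Aop; ring)
  have hK : IntegrableOn (fun y => u y ^ 2 / (1 + y ^ 5) * y) (Ioi 0) := by
    refine Integrable.mono' (hU.const_mul 8) (ContinuousOn.aestronglyMeasurable ?_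
      measurableSet_Ioi) ((ae_restrict_mem measurableSet_Ioi).mono fun y hy => ?_)
    · refine ((hu.continuousOn.pow 2).div (by fun_prop) fun y hy => ?_).mul continuousOn_id
      have : 0 < y := hy
      positivity
    · have hy0 : 0 < y := hy
      rw [Real.norm_of_nonneg (by positivity)]
      exact sq_div_one_add_pow_five_le hy0 (u y)
  have hE : ∫ y in Ioi (0:ℝ), Hop u y ^ 2 * y = (∫ y in Ioi (0:ℝ), deriv (Aop u) y ^ 2 * y)
      + 4 * ∫ y in Ioi (0:ℝ), Aop u y ^ 2 / (y ^ 2 * (1 + y ^ 2)) * y := by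
    rw [← integral_sq_add_eq hw hw₁ h1 h2]
    refine setIntegral_congr_fun measurableSet_Ioi fun y hy => ?_
    have hy0 : 0 < y := hy
    have : Hop u y = deriv (Aop u) y + 2 / (y * (1 + y ^ 2)) * Aop u y := by
      rw [hdA y hy0]
      unfold Hop Aop Vfun Zfun
      field_simp
      ring
    simp only [this]
  obtain ⟨hP, hPle⟩ := integral_sq_div_log_le hw h1 h2
  obtain ⟨hB, hBle⟩ := integral_sq_div_logZero_le hu' h2 hK
  obtain ⟨hD, hDle⟩ := integral_sq_div_logInfty_le hu' hP hK
  have hUle : ∫ y in Ioi (0:ℝ), u y ^ 2 / (y ^ 4 * (1 + |Real.log y|) ^ 2) * y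
      ≤ 16 * ((∫ y in Ioi (0:ℝ), u y ^ 2 / (y ^ 3 * (1 + y ^ 2) ^ 3 * logZero y ^ 2))
        + ∫ y in Ioi (0:ℝ), u y ^ 2 * y ^ 3 / ((1 + y ^ 2) ^ 3 * logInfty y ^ 2)) := by
    rw [← integral_add hB hD, ← integral_const_mul]
    exact setIntegral_mono_on hU ((hB.add hD).const_mul 16) measurableSet_Ioi
      fun y hy => sq_div_log_le_add hy (u y)
  have hdu : ∀ y, 0 < y → deriv u y ^ 2 ≤ 2 * (u y ^ 2 / y ^ 2) + 2 * Aop u y ^ 2 := by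
    intro y hy
    have e : deriv u y = Zfun y * (u y / y) - Aop u y := by unfold Aop; ring
    have h3 : (Zfun y * (u y / y)) ^ 2 ≤ (u y / y) ^ 2 := by
      rw [mul_pow]
      exact mul_le_of_le_one_left (sq_nonneg _)
        ((sq_le_one_iff_abs_le_one _).mpr (abs_Zfun_le_one y))
    rw [e, ← div_pow]
    nlinarith [sq_nonneg (Zfun y * (u y / y) + Aop u y)]
  have hddu : ∀ y, 0 < y → deriv (deriv u) y ^ 2
      ≤ 3 * deriv (Aop u) y ^ 2 + 18 * (u y ^ 2 / y ^ 4) + 6 * (Aop u y ^ 2 / y ^ 2) := by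
    intro y hy
    have hZ := abs_le.mp (abs_Zfun_le_one y)
    have e : deriv (deriv u) y = -deriv (Aop u) y
        + (Zfun y ^ 2 - Zfun y - 1) * (u y / y ^ 2) + Zfun y * (deriv u y / y) := by
      rw [hdA y hy]; ring
    have h3 : (Zfun y * (deriv u y / y)) ^ 2 ≤ (deriv u y / y) ^ 2 := by
      rw [mul_pow]
      exact mul_le_of_le_one_left (sq_nonneg _)
        ((sq_le_one_iff_abs_le_one _).mpr (abs_Zfun_le_one y))
    have h4 : ((Zfun y ^ 2 - Zfun y - 1) * (u y / y ^ 2)) ^ 2 ≤ 4 * (u y / y ^ 2) ^ 2 := by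
      rw [mul_pow]
      refine mul_le_mul_of_nonneg_right ?_ (sq_nonneg _)
      rw [show (4:ℝ) = 2 ^ 2 by norm_num]
      refine sq_le_sq' ?_ ?_ <;> nlinarith
    have h5 : (deriv u y / y) ^ 2 ≤ 2 * (u y / y ^ 2) ^ 2 + 2 * (Aop u y / y) ^ 2 := by
      rw [div_pow, div_le_iff₀ (by positivity)]
      have : (2 * (u y / y ^ 2) ^ 2 + 2 * (Aop u y / y) ^ 2) * y ^ 2
          = 2 * (u y ^ 2 / y ^ 2) + 2 * Aop u y ^ 2 := by field_simp
      rw [this]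
      exact hdu y hy
    have h6 : u y ^ 2 / y ^ 4 = (u y / y ^ 2) ^ 2 := by rw [div_pow]; ring
    rw [h6, ← div_pow, e]
    set p := (Zfun y ^ 2 - Zfun y - 1) * (u y / y ^ 2)
    set q := Zfun y * (deriv u y / y)
    nlinarith [sq_nonneg (deriv (Aop u) y + p), sq_nonneg (deriv (Aop u) y + q),
      sq_nonneg (p - q)]
  have hU1 : ∫ y in Ioi (0:ℝ), deriv u y ^ 2 / (y ^ 2 * (1 + |Real.log y|) ^ 2) * y
      ≤ 2 * (∫ y in Ioi (0:ℝ), u y ^ 2 / (y ^ 4 * (1 + |Real.log y|) ^ 2) * y)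
        + 8 * ∫ y in Ioi (0:ℝ), Aop u y ^ 2 / (y * logInfty y ^ 2) := by
    rw [← integral_const_mul, ← integral_const_mul,
      ← integral_add (hU.const_mul 2) (hP.const_mul 8)]
    refine integral_mono_of_nonneg ((ae_restrict_mem measurableSet_Ioi).mono fun y hy => ?_)
      ((hU.const_mul 2).add (hP.const_mul 8))
      ((ae_restrict_mem measurableSet_Ioi).mono fun y hy => ?_)
    · have hy0 : 0 < y := hy
      simp only [Pi.zero_apply]
      positivity
    · have hy0 : 0 < y := hy
      have h3 := sq_div_le_sq_div_logInfty hy0 (Aop u y)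
      have h4 : deriv u y ^ 2 / (y ^ 2 * (1 + |Real.log y|) ^ 2) * y
          ≤ (2 * (u y ^ 2 / y ^ 2) + 2 * Aop u y ^ 2) / (y ^ 2 * (1 + |Real.log y|) ^ 2) * y := by
        gcongr
        exact hdu y hy0
      have h5 : (2 * (u y ^ 2 / y ^ 2) + 2 * Aop u y ^ 2) / (y ^ 2 * (1 + |Real.log y|) ^ 2) * y
          = 2 * (u y ^ 2 / (y ^ 4 * (1 + |Real.log y|) ^ 2) * y)
            + 2 * (Aop u y ^ 2 / (y * (1 + |Real.log y|) ^ 2)) := by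
        field_simp
      linarith
  have hU2 : ∫ y in Ioi (0:ℝ), deriv (deriv u) y ^ 2 / (1 + |Real.log y|) ^ 2 * y
      ≤ 3 * (∫ y in Ioi (0:ℝ), deriv (Aop u) y ^ 2 * y)
        + 18 * (∫ y in Ioi (0:ℝ), u y ^ 2 / (y ^ 4 * (1 + |Real.log y|) ^ 2) * y)
        + 24 * ∫ y in Ioi (0:ℝ), Aop u y ^ 2 / (y * logInfty y ^ 2) := by
    have h12 : IntegrableOn (fun y => 3 * (deriv (Aop u) y ^ 2 * y)
        + 18 * (u y ^ 2 / (y ^ 4 * (1 + |Real.log y|) ^ 2) * y)) (Ioi 0) := (h1.const_mul 3).add (hU.const_mul 18)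
    rw [← integral_const_mul, ← integral_const_mul, ← integral_const_mul,
      ← integral_add (h1.const_mul 3) (hU.const_mul 18), ← integral_add h12 (hP.const_mul 24)]
    refine integral_mono_of_nonneg ((ae_restrict_mem measurableSet_Ioi).mono fun y hy => ?_)
      (h12.add (hP.const_mul 24))
      ((ae_restrict_mem measurableSet_Ioi).mono fun y hy => ?_)
    · have hy0 : 0 < y := hy
      simp only [Pi.zero_apply]
      positivity
    · have hy0 : 0 < y := hy
      have h3 := sq_div_le_sq_div_logInfty hy0 (Aop u y)
      have h4 : deriv (deriv u) y ^ 2 / (1 + |Real.log y|) ^ 2 * y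
          ≤ (3 * deriv (Aop u) y ^ 2 + 18 * (u y ^ 2 / y ^ 4) + 6 * (Aop u y ^ 2 / y ^ 2))
            / (1 + |Real.log y|) ^ 2 * y := by
        gcongr
        exact hddu y hy0
      have h5 : (3 * deriv (Aop u) y ^ 2 + 18 * (u y ^ 2 / y ^ 4) + 6 * (Aop u y ^ 2 / y ^ 2))
            / (1 + |Real.log y|) ^ 2 * y
          = 3 * (deriv (Aop u) y ^ 2 / (1 + |Real.log y|) ^ 2 * y)
            + 18 * (u y ^ 2 / (y ^ 4 * (1 + |Real.log y|) ^ 2) * y)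
            + 6 * (Aop u y ^ 2 / (y * (1 + |Real.log y|) ^ 2)) := by
        field_simp
      have h6 : deriv (Aop u) y ^ 2 / (1 + |Real.log y|) ^ 2 * y ≤ deriv (Aop u) y ^ 2 * y := by
        refine mul_le_mul_of_nonneg_right (div_le_self (sq_nonneg _) (one_le_pow₀ ?_)) hy0.le
        linarith [abs_nonneg (Real.log y)]
      linarith
  have hI1 : 0 ≤ ∫ y in Ioi (0:ℝ), deriv (Aop u) y ^ 2 * y :=
    setIntegral_nonneg measurableSet_Ioi fun y hy => by
      have : 0 < y := hy
      positivity
  have hI2 : 0 ≤ ∫ y in Ioi (0:ℝ), Aop u y ^ 2 / (y ^ 2 * (1 + y ^ 2)) * y :=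
    setIntegral_nonneg measurableSet_Ioi fun y hy => by
      have : 0 < y := hy
      positivity
  have hK0 : 0 ≤ ∫ y in Ioi (0:ℝ), u y ^ 2 / (1 + y ^ 5) * y :=
    setIntegral_nonneg measurableSet_Ioi fun y hy => by
      have : 0 < y := hy
      positivity
  rw [hE]
  refine ⟨by linarith, by linarith, ?_⟩
  linarith
end
end

section
/- (Weighted sub-coercivity for H.) There exist universal constants c > 0 and C > 0 such that for every u ∈ C³((0,∞)) satisfying ∫ (Hu)²/(y⁴(1+|log y|)²) + ∫ ((Hu)')²/(y²(1+|log y|)²) + ∫ u²/(y⁴(1+y⁴)(1+|log y|)²) + ∫ (u')²/(y²(1+y⁴)(1+|log y|)²) < ∞ (all integrals with respect to y dy on (0,∞)): ∫ (Hu)²/(y⁴(1+|log y|)²) + ∫ ((Hu)')²/(y²(1+|log y|)²) ≥ c·[ ∫ u²/(y⁴(1+y⁴)(1+|log y|)²) + ∫ (u')²/(y²(1+y⁴)(1+|log y|)²) + ∫ (u'')²/(y⁴(1+|log y|)²) + ∫ (u''')²/(y²(1+|log y|)²) ] − C·[ ∫ (u')²/(1+y⁸) + ∫ u²/(1+y^{10})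 ]. -/
open MeasureTheory Real Set

noncomputable section

open Filter Topology

/-! ### Integrability criteria on `(0, ∞)` -/

theorem integrableOn_Ioi_zero_of_setIntegral_Icc_le {f : ℝ → ℝ} {K : ℝ}
    (hf : ContinuousOn f (Ioi 0)) (f0 : ∀ y > 0, 0 ≤ f y)
    (hK : ∀ a b : ℝ, 0 < a → a ≤ b → ∫ y in Icc a b, f y ≤ K) :
    IntegrableOn f (Ioi 0) ∧ ∫ y in Ioi 0, f y ≤ K := by
  have hcov : AECover (volume.restrict (Ioi (0 : ℝ))) atTop
      (fun n : ℕ => Icc (1 / ((n : ℝ) + 1)) ((n : ℝ) + 1)) :=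
    (aecover_Ioi_of_Ici tendsto_one_div_add_atTop_nhds_zero_nat).inter
      ((aecover_Iic (tendsto_natCast_atTop_atTop.atTop_add tendsto_const_nhds)).mono
        Measure.restrict_le_self)
  have hpos : ∀ n : ℕ, 0 < 1 / ((n : ℝ) + 1) := fun n => Nat.one_div_pos_of_nat
  have hsub : ∀ n : ℕ, Icc (1 / ((n : ℝ) + 1)) ((n : ℝ) + 1) ⊆ Ioi 0 :=
    fun n y hy => (hpos n).trans_le hy.1
  have hle : ∀ n : ℕ, 1 / ((n : ℝ) + 1) ≤ (n : ℝ) + 1 := fun n => by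
    have : (1 : ℝ) ≤ n + 1 := by linarith [n.cast_nonneg (α := ℝ)]
    exact (div_le_one (by positivity)).2 this |>.trans this
  have hrestr : ∀ n : ℕ, (volume.restrict (Ioi (0 : ℝ))).restrict
      (Icc (1 / ((n : ℝ) + 1)) ((n : ℝ) + 1)) =
      volume.restrict (Icc (1 / ((n : ℝ) + 1)) ((n : ℝ) + 1)) := fun n =>
    Measure.restrict_restrict_of_subset (hsub n)
  have hbd : ∀ n : ℕ, ∫ y in Icc (1 / ((n : ℝ) + 1)) ((n : ℝ) + 1), f y
      ∂(volume.restrict (Ioi (0 : ℝ))) ≤ K := fun n => by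
    rw [hrestr]; exact hK _ _ (hpos n) (hle n)
  have hint : IntegrableOn f (Ioi 0) := by
    refine hcov.integrable_of_integral_bounded_of_nonneg_ae K (fun n => ?_)
      ((ae_restrict_iff' measurableSet_Ioi).2 (Eventually.of_forall f0)) (Eventually.of_forall hbd)
    rw [IntegrableOn, hrestr]
    exact (hf.mono (hsub n)).integrableOn_Icc
  exact ⟨hint, le_of_tendsto (hcov.integral_tendsto_of_countably_generated hint)
    (Eventually.of_forall hbd)⟩

/-- Integration of the differential inequality `f + Φ' ≤ g` over `(0, ∞)`, when the boundary
contributions of `Φ` have the favourable sign along sequences tending to `0` and `∞`. -/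
theorem integrableOn_Ioi_zero_of_add_deriv_le {f g Φ D : ℝ → ℝ}
    (hf : ContinuousOn f (Ioi 0)) (f0 : ∀ y > 0, 0 ≤ f y)
    (hg : IntegrableOn g (Ioi 0)) (g0 : ∀ y > 0, 0 ≤ g y)
    (hD : ∀ y > 0, HasDerivAt Φ (D y) y) (hle : ∀ y > 0, f y + D y ≤ g y)
    (h0 : ∀ ε > 0, ∀ a > 0, ∃ x, 0 < x ∧ x < a ∧ Φ x ≤ ε)
    (h1 : ∀ ε > 0, ∀ a > 0, ∃ x, a < x ∧ -ε ≤ Φ x) :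
    IntegrableOn f (Ioi 0) ∧ ∫ y in Ioi 0, f y ≤ ∫ y in Ioi 0, g y := by
  refine integrableOn_Ioi_zero_of_setIntegral_Icc_le hf f0 fun a b ha hab => ?_
  refine le_of_forall_pos_le_add fun ε hε => ?_
  obtain ⟨x, hx0, hxa, hx⟩ := h0 (ε / 2) (half_pos hε) a ha
  obtain ⟨z, hbz, hz⟩ := h1 (ε / 2) (half_pos hε) b (ha.trans_le hab)
  have hxz : x ≤ z := by linarith
  have hsub : Icc x z ⊆ Ioi 0 := fun y hy => hx0.trans_le hy.1
  have hfi : IntegrableOn f (Icc x z) := (hf.mono hsub).integrableOn_Icc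
  have hgi : IntegrableOn g (Icc x z) := hg.mono_set hsub
  have key := intervalIntegral.sub_le_integral_of_hasDeriv_right_of_le (φ := fun y => g y - f y)
    hxz (fun y hy => (hD y (hsub hy)).continuousAt.continuousWithinAt)
    (fun y hy => (hD y (hsub (Ioo_subset_Icc_self hy))).hasDerivWithinAt)
    (hgi.sub hfi) (fun y hy => by linarith [hle y (hsub (Ioo_subset_Icc_self hy))])
  rw [intervalIntegral.integral_of_le hxz, ← integral_Icc_eq_integral_Ioc,
    integral_sub hgi hfi] at key
  have e1 : ∫ y in Icc a b, f y ≤ ∫ y in Icc x z, f y :=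
    setIntegral_mono_set hfi ((ae_restrict_iff' measurableSet_Icc).2
      (Eventually.of_forall fun y hy => f0 y (hsub hy)))
      (Icc_subset_Icc hxa.le hbz.le).eventuallyLE
  have e2 : ∫ y in Icc x z, g y ≤ ∫ y in Ioi 0, g y :=
    setIntegral_mono_set hg ((ae_restrict_iff' measurableSet_Ioi).2
      (Eventually.of_forall g0)) hsub.eventuallyLE
  linarith

theorem exists_lt_le_of_integrableOn_div {h : ℝ → ℝ}
    (hi : IntegrableOn (fun y => h y / y) (Ioi 0)) {ε a : ℝ} (hε : 0 < ε) (ha : 0 < a) :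
    ∃ x, 0 < x ∧ x < a ∧ h x ≤ ε := by
  by_contra! hcon
  have h1 : IntegrableOn (fun y : ℝ => ε * y⁻¹) (Ioo 0 a) := by
    refine Integrable.mono' (hi.mono_set Ioo_subset_Ioi_self) (by fun_prop) ?_
    refine (ae_restrict_iff' measurableSet_Ioo).2 (Eventually.of_forall fun y hy => ?_)
    have hy0 : 0 < y := hy.1
    rw [norm_of_nonneg (by positivity), div_eq_mul_inv]
    exact mul_le_mul_of_nonneg_right (hcon y hy.1 hy.2).le (by positivity)
  have h2 : IntervalIntegrable (fun y : ℝ => y⁻¹) volume 0 a := by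
    rw [intervalIntegrable_iff_integrableOn_Ioo_of_le ha.le]
    have := h1.const_mul ε⁻¹
    refine this.congr (Eventually.of_forall fun y => ?_)
    simp only [← mul_assoc, inv_mul_cancel₀ hε.ne', one_mul]
  rw [intervalIntegrable_inv_iff] at h2
  rcases h2 with h2 | h2
  · exact ha.ne h2
  · exact h2 left_mem_uIcc

theorem exists_gt_le_of_integrableOn_div {h : ℝ → ℝ}
    (hi : IntegrableOn (fun y => h y / y) (Ioi 0)) {ε a : ℝ} (hε : 0 < ε) (ha : 0 < a) :
    ∃ x, a < x ∧ h x ≤ ε := by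
  by_contra! hcon
  have h1 : IntegrableOn (fun y : ℝ => ε * y⁻¹) (Ioi a) := by
    refine Integrable.mono' (hi.mono_set (Ioi_subset_Ioi ha.le)) (by fun_prop) ?_
    refine (ae_restrict_iff' measurableSet_Ioi).2 (Eventually.of_forall fun y hy => ?_)
    have hy0 : 0 < y := ha.trans hy
    rw [norm_of_nonneg (by positivity), div_eq_mul_inv]
    exact mul_le_mul_of_nonneg_right (hcon y hy).le (by positivity)
  refine not_integrableOn_Ioi_inv (a := a) ((h1.const_mul ε⁻¹).congr (Eventually.of_forall fun y => ?_))
  simp only [← mul_assoc, inv_mul_cancel₀ hε.ne', one_mul]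

theorem integrableOn_Ioi_zero_of_le {f g : ℝ → ℝ} (hf : ContinuousOn f (Ioi 0))
    (f0 : ∀ y > 0, 0 ≤ f y) (hg : IntegrableOn g (Ioi 0)) (hle : ∀ y > 0, f y ≤ g y) :
    IntegrableOn f (Ioi 0) := by
  refine Integrable.mono' hg (hf.aestronglyMeasurable measurableSet_Ioi) ?_
  refine (ae_restrict_iff' measurableSet_Ioi).2 (Eventually.of_forall fun y hy => ?_)
  rw [norm_of_nonneg (f0 y hy)]
  exact hle y hy

theorem setIntegral_Ioi_zero_mono {f g : ℝ → ℝ} (f0 : ∀ y > 0, 0 ≤ f y)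
    (hg : IntegrableOn g (Ioi 0)) (hle : ∀ y > 0, f y ≤ g y) :
    ∫ y in Ioi 0, f y ≤ ∫ y in Ioi 0, g y :=
  integral_mono_of_nonneg ((ae_restrict_iff' measurableSet_Ioi).2 (Eventually.of_forall f0)) hg
    ((ae_restrict_iff' measurableSet_Ioi).2 (Eventually.of_forall hle))

/-! ### The logarithmic weight -/

/-- The smooth weight `1 / (1 + log² y)`, comparable to `1 / (1 + |log y|)²`. -/
def logWeight (y : ℝ) : ℝ := 1 / (1 + log y ^ 2)

theorem logWeight_pos (y : ℝ) : 0 < logWeight y := by unfold logWeight; positivity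

theorem logWeight_le_one (y : ℝ) : logWeight y ≤ 1 := by
  unfold logWeight
  rw [div_le_one (by positivity)]
  nlinarith [sq_nonneg (log y)]

theorem inv_sq_le_logWeight (y : ℝ) : 1 / (1 + |log y|) ^ 2 ≤ logWeight y := by
  unfold logWeight
  refine one_div_le_one_div_of_le (by positivity) ?_
  nlinarith [abs_nonneg (log y), sq_abs (log y)]

theorem logWeight_le (y : ℝ) : logWeight y ≤ 2 * (1 / (1 + |log y|) ^ 2) := by
  unfold logWeight
  rw [← mul_div_assoc, mul_one, div_le_div_iff₀ (by positivity) (by positivity)]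
  nlinarith [sq_nonneg (1 - |log y|), sq_abs (log y)]

theorem one_le_logWeight_mul {y : ℝ} (hy : 0 < y) : 1 ≤ logWeight y * (5 * (y + 1 / y)) := by
  have hs : 0 < √y := sqrt_pos.2 hy
  have h1 : log √y ≤ √y := (log_le_sub_one_of_pos hs).trans (by linarith)
  have h2 : -(1 / √y) ≤ log √y := by
    have := log_le_sub_one_of_pos (inv_pos.2 hs)
    rw [log_inv, inv_eq_one_div] at this
    linarith
  have h3 : log √y ^ 2 ≤ y + 1 / y := by
    have e1 : √y ^ 2 = y := sq_sqrt hy.le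
    have e2 : (1 / √y) ^ 2 = 1 / y := by rw [div_pow, e1, one_pow]
    have := one_div_pos.2 hs
    rcases le_total 0 (log √y) with h | h
    · nlinarith
    · nlinarith
  have h4 : log y = 2 * log √y := by rw [log_sqrt hy.le]; ring
  have h5 : 2 ≤ y + 1 / y := by
    rw [← sub_nonneg]
    have : y + 1 / y - 2 = (y - 1) ^ 2 / y := by field_simp; ring
    rw [this]; positivity
  unfold logWeight
  rw [div_mul_eq_mul_div, one_mul, one_le_div (by positivity), h4]
  nlinarith

theorem hasDerivAt_logWeight {y : ℝ} (hy : 0 < y) :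
    HasDerivAt logWeight (-(2 * log y / y) * logWeight y ^ 2) y := by
  have h := (((hasDerivAt_log hy.ne').pow 2).const_add 1).inv (by positivity : 1 + log y ^ 2 ≠ 0)
  unfold logWeight
  refine (h.congr_of_eventuallyEq (Eventually.of_forall fun z => ?_)).congr_deriv ?_
  · simp
  · simp; field_simp

theorem abs_deriv_logWeight_le {y : ℝ} (hy : 0 < y) :
    |-(2 * log y / y) * logWeight y ^ 2| ≤ logWeight y / y := by
  have h : 0 < 1 + log y ^ 2 := by positivity
  rw [abs_mul, abs_neg, abs_div, abs_mul, abs_two, abs_of_pos hy, abs_of_nonneg (sq_nonneg (logWeight y))]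
  unfold logWeight
  have : 2 * |log y| ≤ 1 + log y ^ 2 := by nlinarith [sq_nonneg (1 - |log y|), sq_abs (log y)]
  calc 2 * |log y| / y * (1 / (1 + log y ^ 2)) ^ 2
      ≤ (1 + log y ^ 2) / y * (1 / (1 + log y ^ 2)) ^ 2 := by gcongr
    _ = _ := by field_simp

theorem continuousOn_logWeight : ContinuousOn logWeight (Ioi 0) := fun _ hy =>
  (hasDerivAt_logWeight hy).continuousAt.continuousWithinAt

/-! ### Pointwise inequalities -/

theorem pow_le_one_add_pow {y : ℝ} (hy : 0 ≤ y) {m n : ℕ} (hmn : m ≤ n) : y ^ m ≤ 1 + y ^ n := by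
  rcases le_total y 1 with h | h
  · exact (pow_le_one₀ hy h).trans (le_add_of_nonneg_right (by positivity))
  · exact (pow_le_pow_right₀ h hmn).trans (by linarith)

theorem energy_deriv_le {y r k r' k' p G : ℝ} (hy : 0 < y) (hr : 0 < r) (hk : 0 < k)
    (hky : k ≤ 1 / y ^ 4) (hr' : |r'| ≤ r / y) (hk' : k' ≤ 0) :
    2 * p ^ 2 * r * k / y + (2 * p * (-G - 2 * p / y) * (r * k) + p ^ 2 * (r' * k + r * k')) ≤
      G ^ 2 * r / y ^ 3 := by
  have h1 : p ^ 2 * (r' * k) ≤ p ^ 2 * (r / y * k) := by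
    gcongr; exact (le_abs_self r').trans hr'
  have h2 : p ^ 2 * (r * k') ≤ 0 :=
    mul_nonpos_of_nonneg_of_nonpos (sq_nonneg p) (mul_nonpos_of_nonneg_of_nonpos hr.le hk')
  have h3 : 0 ≤ r * k * ((p + G * y) ^ 2 / y) := by positivity
  have h4 : r * G ^ 2 * y * k ≤ r * G ^ 2 * y * (1 / y ^ 4) := by gcongr
  have h5 : r * G ^ 2 * y * (1 / y ^ 4) = G ^ 2 * r / y ^ 3 := by field_simp
  have h6 : r * k * ((p + G * y) ^ 2 / y) =
      r * k * p ^ 2 / y + 2 * p * G * (r * k) + r * G ^ 2 * y * k := by field_simp; ring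
  have h7 : 2 * p ^ 2 * r * k / y + 2 * p * (-G - 2 * p / y) * (r * k) + p ^ 2 * (r / y * k) =
      -(r * k * p ^ 2 / y) - 2 * p * G * (r * k) := by field_simp; ring
  linarith

theorem sq_add_potential_le {y r F u : ℝ} (hy : 0 < y) (hr : 0 < r) :
    (F + 8 * u / (1 + y ^ 2) ^ 2) ^ 2 * r / y ^ 3 ≤
      2 * (F ^ 2 * r / y ^ 3) + 128 * (u ^ 2 * r / (y ^ 3 * (1 + y ^ 4) ^ 2)) := by
  have h1 : (u / (1 + y ^ 2) ^ 2) ^ 2 ≤ u ^ 2 / (1 + y ^ 4) ^ 2 := by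
    rw [div_pow]
    gcongr
    nlinarith [sq_nonneg y]
  have h2 : (F + 8 * u / (1 + y ^ 2) ^ 2) ^ 2 ≤ 2 * F ^ 2 + 128 * (u ^ 2 / (1 + y ^ 4) ^ 2) := by
    rw [mul_div_assoc]
    nlinarith [sq_nonneg (F - 8 * (u / (1 + y ^ 2) ^ 2))]
  calc _ ≤ (2 * F ^ 2 + 128 * (u ^ 2 / (1 + y ^ 4) ^ 2)) * r / y ^ 3 := by gcongr
    _ = _ := by field_simp

theorem exists_mul_sq_le {ε : ℝ} (hε : 0 < ε) : ∃ C : ℝ, 0 ≤ C ∧ ∀ z > 0,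
    1600 * z / (1 + z ^ 2) ≤ ε + C * (z ^ 4 / (1 + z ^ 5)) := by
  set δ := ε / 1600 with hδ
  have hδ0 : 0 < δ := by positivity
  refine ⟨1600 + 1600 / δ ^ 3, by positivity, fun z hz => ?_⟩
  rcases le_total z δ with h | h
  · have h1 : 1600 * z / (1 + z ^ 2) ≤ ε := by
      rw [div_le_iff₀ (by positivity)]
      have : 1600 * z ≤ ε := by rw [hδ] at h; linarith
      nlinarith [sq_nonneg z]
    have h2 : 0 ≤ (1600 + 1600 / δ ^ 3) * (z ^ 4 / (1 + z ^ 5)) := by positivity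
    linarith
  · have h1 : 1600 * z ≤ 1600 / δ ^ 3 * z ^ 4 := by
      rw [div_mul_eq_mul_div, le_div_iff₀ (by positivity)]
      have : δ ^ 3 ≤ z ^ 3 := by gcongr
      calc 1600 * z * δ ^ 3 ≤ 1600 * z * z ^ 3 := by gcongr
        _ = _ := by ring
    have h2 : 1600 * z / (1 + z ^ 2) ≤ (1600 + 1600 / δ ^ 3) * (z ^ 4 / (1 + z ^ 5)) := by
      rw [← mul_div_assoc, div_le_div_iff₀ (by positivity) (by positivity)]
      have : 0 ≤ (1600 / δ ^ 3) * z ^ 6 := by positivity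
      have : 0 ≤ z ^ 4 := by positivity
      nlinarith
    linarith

theorem exists_cross_coeff_le {ε : ℝ} (hε : 0 < ε) : ∃ C : ℝ, 0 ≤ C ∧ ∀ y > 0,
    32 / (logWeight y * y * (1 + y ^ 4) ^ 2) ≤
      ε * (logWeight y / y ^ 5) + C * (y ^ 3 / (1 + y ^ 10)) := by
  obtain ⟨C, hC, h⟩ := exists_mul_sq_le hε
  refine ⟨C, hC, fun y hy => ?_⟩
  have hr := logWeight_pos y
  have hr1 := logWeight_le_one y
  have hq := one_le_logWeight_mul hy
  set r := logWeight y
  have h1 : 1 ≤ r ^ 2 * (25 * (y + 1 / y) ^ 2) := by nlinarith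
  have h2 : y ^ 2 * (y + 1 / y) ^ 2 ≤ 2 * (1 + y ^ 4) := by
    have : y ^ 2 * (y + 1 / y) ^ 2 = (1 + y ^ 2) ^ 2 := by field_simp; ring
    rw [this]; nlinarith [sq_nonneg (1 - y ^ 2)]
  calc 32 / (r * y * (1 + y ^ 4) ^ 2)
      ≤ 32 * (r ^ 2 * (25 * (y + 1 / y) ^ 2)) / (r * y * (1 + y ^ 4) ^ 2) := by
        gcongr; linarith
    _ = r / y ^ 5 * (800 * y ^ 2 * (y ^ 2 * (y + 1 / y) ^ 2) / (1 + y ^ 4) ^ 2) := by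
        field_simp; ring
    _ ≤ r / y ^ 5 * (800 * y ^ 2 * (2 * (1 + y ^ 4)) / (1 + y ^ 4) ^ 2) := by gcongr
    _ = r / y ^ 5 * (1600 * y ^ 2 / (1 + (y ^ 2) ^ 2)) := by
        field_simp; ring
    _ ≤ r / y ^ 5 * (ε + C * ((y ^ 2) ^ 4 / (1 + (y ^ 2) ^ 5))) := by
        gcongr; exact h (y ^ 2) (by positivity)
    _ = ε * (r / y ^ 5) + r * (C * (y ^ 3 / (1 + y ^ 10))) := by field_simp
    _ ≤ _ := by
        have : 0 ≤ C * (y ^ 3 / (1 + y ^ 10)) := by positivity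
        nlinarith

theorem sq_sub_mul_le {y u v : ℝ} (hy : 0 < y) :
    (v - u / y) ^ 2 * (y ^ 3 / (1 + y ^ 10)) ≤
      4 * (v ^ 2 * y / (1 + y ^ 8) + u ^ 2 * y / (1 + y ^ 10)) := by
  have h1 : (v - u / y) ^ 2 ≤ 2 * v ^ 2 + 2 * (u / y) ^ 2 := by nlinarith [sq_nonneg (v + u / y)]
  have h2 : v ^ 2 * (y ^ 3 / (1 + y ^ 10)) ≤ 2 * (v ^ 2 * y / (1 + y ^ 8)) := by
    have : y ^ 3 / (1 + y ^ 10) ≤ 2 * (y / (1 + y ^ 8)) := by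
      rw [← mul_div_assoc, div_le_div_iff₀ (by positivity) (by positivity)]
      have : y ^ 2 ≤ 1 + y ^ 10 := pow_le_one_add_pow hy.le (by norm_num)
      have := mul_le_mul_of_nonneg_left this hy.le
      have : 0 < y ^ 11 := by positivity
      nlinarith
    calc _ ≤ v ^ 2 * (2 * (y / (1 + y ^ 8))) := by gcongr
      _ = _ := by ring
  have h3 : (u / y) ^ 2 * (y ^ 3 / (1 + y ^ 10)) = u ^ 2 * y / (1 + y ^ 10) := by field_simp
  have h4 : 0 ≤ u ^ 2 * y / (1 + y ^ 10) := by positivity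
  calc _ ≤ (2 * v ^ 2 + 2 * (u / y) ^ 2) * (y ^ 3 / (1 + y ^ 10)) := by gcongr
    _ = 2 * (v ^ 2 * (y ^ 3 / (1 + y ^ 10))) + 2 * ((u / y) ^ 2 * (y ^ 3 / (1 + y ^ 10))) := by ring
    _ ≤ _ := by rw [h3]; linarith

theorem mul_deriv_cutoff_le {y u θ : ℝ} (hy : 0 < y) (hθ : θ ≤ 4) :
    (u / y) ^ 2 * θ * (8 * y ^ 3 / (1 + y ^ 4) ^ 3) ≤ 64 * (u ^ 2 * y / (1 + y ^ 10)) := by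
  have h1 : 1 + y ^ 10 ≤ 2 * (1 + y ^ 4) ^ 3 := by
    have h2 : y ^ 10 ≤ 1 + y ^ 12 := pow_le_one_add_pow hy.le (by norm_num)
    have : 0 < y ^ 4 := by positivity
    have : 0 < y ^ 8 := by positivity
    nlinarith
  have h3 : 1 / (1 + y ^ 4) ^ 3 ≤ 2 / (1 + y ^ 10) := by
    rw [div_le_div_iff₀ (by positivity) (by positivity)]; linarith
  calc (u / y) ^ 2 * θ * (8 * y ^ 3 / (1 + y ^ 4) ^ 3)
      ≤ (u / y) ^ 2 * 4 * (8 * y ^ 3 / (1 + y ^ 4) ^ 3) := by gcongr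
    _ = 32 * u ^ 2 * y * (1 / (1 + y ^ 4) ^ 3) := by field_simp; ring
    _ ≤ 32 * u ^ 2 * y * (2 / (1 + y ^ 10)) := by gcongr
    _ = _ := by ring

theorem cutoff_deriv_le {y r u v θ ε C : ℝ} (hy : 0 < y) (hr : 0 < r) (hC : 0 ≤ C)
    (hθ0 : 0 ≤ θ) (hθ : θ ≤ 4)
    (hc : 32 / (r * y * (1 + y ^ 4) ^ 2) ≤ ε * (r / y ^ 5) + C * (y ^ 3 / (1 + y ^ 10))) :
    u ^ 2 * r / (y ^ 3 * (1 + y ^ 4) ^ 2) / 2 +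
      -(2 * (u / y) * ((v - u / y) / y) * (θ * (1 / (1 + y ^ 4) ^ 2)) +
        (u / y) ^ 2 * (r / y * (1 / (1 + y ^ 4) ^ 2) + θ * -(8 * y ^ 3 / (1 + y ^ 4) ^ 3))) ≤
      ε * ((v - u / y) ^ 2 * r / y ^ 5) +
        (4 * C + 64) * (v ^ 2 * y / (1 + y ^ 8) + u ^ 2 * y / (1 + y ^ 10)) := by
  have h1 := mul_deriv_cutoff_le (u := u) hy hθ
  have h2 := mul_le_mul_of_nonneg_left (sq_sub_mul_le (u := u) (v := v) hy) hC
  have hv : 0 ≤ v ^ 2 * y / (1 + y ^ 8) := by positivity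
  set p := v - u / y
  set w := u / y with hw
  have hu : u = w * y := by rw [hw]; field_simp
  have h3 := mul_le_mul_of_nonneg_left hc (sq_nonneg p)
  have h4 : 2 * p ^ 2 * θ ^ 2 / (r * y * (1 + y ^ 4) ^ 2) ≤
      p ^ 2 * (32 / (r * y * (1 + y ^ 4) ^ 2)) := by
    rw [← mul_div_assoc]
    gcongr ?_ / _
    have : θ ^ 2 ≤ 16 := by nlinarith
    nlinarith [sq_nonneg p]
  have h5 : 0 ≤ (w * r + 2 * p * θ) ^ 2 / (2 * r * y * (1 + y ^ 4) ^ 2) := by positivity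
  have h6 : (w * r + 2 * p * θ) ^ 2 / (2 * r * y * (1 + y ^ 4) ^ 2) =
      w ^ 2 * r / (y * (1 + y ^ 4) ^ 2) / 2 + 2 * w * (p / y) * (θ * (1 / (1 + y ^ 4) ^ 2)) +
        2 * p ^ 2 * θ ^ 2 / (r * y * (1 + y ^ 4) ^ 2) := by
    field_simp; ring
  have h7 : u ^ 2 * r / (y ^ 3 * (1 + y ^ 4) ^ 2) = w ^ 2 * r / (y * (1 + y ^ 4) ^ 2) := by
    rw [hu]; field_simp
  have h8 : w ^ 2 * (r / y * (1 / (1 + y ^ 4) ^ 2)) = w ^ 2 * r / (y * (1 + y ^ 4) ^ 2) := by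
    field_simp
  have h9 : p ^ 2 * (ε * (r / y ^ 5)) = ε * (p ^ 2 * r / y ^ 5) := by ring
  rw [h7]
  nlinarith

theorem hardy_deriv_le {y r r' u v : ℝ} (hy : 0 < y) (hr : 0 < r) (hr' : |r'| ≤ r / y) :
    u ^ 2 * r / (y ^ 3 * (1 + y ^ 4)) / 2 +
      (2 * (u / y) * ((v - u / y) / y) * (r * (y ^ 4 / (1 + y ^ 4) ^ 2)) +
        (u / y) ^ 2 * (r' * (y ^ 4 / (1 + y ^ 4) ^ 2) +
          r * ((4 * y ^ 3 - 4 * y ^ 7) / (1 + y ^ 4) ^ 3))) ≤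
      8 * (u ^ 2 * r / (y ^ 3 * (1 + y ^ 4) ^ 2)) + 2 * ((v - u / y) ^ 2 * r / y ^ 5) := by
  set p := v - u / y
  set w := u / y with hw
  have hu : u = w * y := by rw [hw]; field_simp
  rw [hu]
  have h1 : w ^ 2 * (r' * (y ^ 4 / (1 + y ^ 4) ^ 2)) ≤ w ^ 2 * (r / y * (y ^ 4 / (1 + y ^ 4) ^ 2)) := by
    gcongr; exact (le_abs_self r').trans hr'
  have h2 : y ^ 4 / (1 + y ^ 4) ^ 2 / y + (4 * y ^ 3 - 4 * y ^ 7) / (1 + y ^ 4) ^ 3 ≤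
      8 / (y * (1 + y ^ 4) ^ 2) - 1 / (y * (1 + y ^ 4)) := by
    rw [← sub_nonneg]
    have : 8 / (y * (1 + y ^ 4) ^ 2) - 1 / (y * (1 + y ^ 4)) -
      (y ^ 4 / (1 + y ^ 4) ^ 2 / y + (4 * y ^ 3 - 4 * y ^ 7) / (1 + y ^ 4) ^ 3) =
      (7 + y ^ 4 + 2 * y ^ 8) / (y * (1 + y ^ 4) ^ 3) := by field_simp; ring
    rw [this]; positivity
  have h3 := mul_le_mul_of_nonneg_left h2 (by positivity : 0 ≤ w ^ 2 * r)
  have h4 : 0 ≤ (1 + y ^ 4) * r / (2 * y) * (w / (1 + y ^ 4) - 2 * p * (y ^ 4 / (1 + y ^ 4) ^ 2)) ^ 2 := by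
    positivity
  have h5 : 2 * p ^ 2 * r * (y ^ 7 / (1 + y ^ 4) ^ 3) ≤ 2 * p ^ 2 * r * (1 / y ^ 5) := by
    gcongr ?_ * ?_
    rw [div_le_div_iff₀ (by positivity) (by positivity)]
    have : 0 < y ^ 4 := by positivity
    have : 0 < y ^ 8 := by positivity
    nlinarith
  have h6 : (1 + y ^ 4) * r / (2 * y) * (w / (1 + y ^ 4) - 2 * p * (y ^ 4 / (1 + y ^ 4) ^ 2)) ^ 2 =
      w ^ 2 * r / (y * (1 + y ^ 4)) / 2 - 2 * w * (p / y) * (r * (y ^ 4 / (1 + y ^ 4) ^ 2)) +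
        2 * p ^ 2 * r * (y ^ 7 / (1 + y ^ 4) ^ 3) := by
    field_simp; ring
  have h7 : (w * y) ^ 2 * r / (y ^ 3 * (1 + y ^ 4)) = w ^ 2 * r / (y * (1 + y ^ 4)) := by field_simp
  have h8 : (w * y) ^ 2 * r / (y ^ 3 * (1 + y ^ 4) ^ 2) = w ^ 2 * r / (y * (1 + y ^ 4) ^ 2) := by
    field_simp
  rw [h7, h8]
  have h9 : 2 * p ^ 2 * r * (1 / y ^ 5) = 2 * (p ^ 2 * r / y ^ 5) := by ring
  have h10 : w ^ 2 * r * (8 / (y * (1 + y ^ 4) ^ 2) - 1 / (y * (1 + y ^ 4))) =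
      8 * (w ^ 2 * r / (y * (1 + y ^ 4) ^ 2)) - w ^ 2 * r / (y * (1 + y ^ 4)) := by ring
  have h11 : w ^ 2 * (r / y * (y ^ 4 / (1 + y ^ 4) ^ 2)) = w ^ 2 * r * (y ^ 4 / (1 + y ^ 4) ^ 2 / y) := by
    ring
  nlinarith

theorem sq_div_le_of_sub_div {y r u v : ℝ} (hy : 0 < y) (hr : 0 < r) :
    v ^ 2 * r / (y * (1 + y ^ 4)) ≤
      2 * ((v - u / y) ^ 2 * r / y ^ 5) + 2 * (u ^ 2 * r / (y ^ 3 * (1 + y ^ 4))) := by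
  have h1 : v ^ 2 ≤ 2 * (v - u / y) ^ 2 + 2 * (u / y) ^ 2 := by
    nlinarith [sq_nonneg (v - 2 * (u / y))]
  have h2 : 1 / (y * (1 + y ^ 4)) ≤ 1 / y ^ 5 := by
    refine one_div_le_one_div_of_le (by positivity) ?_
    nlinarith
  calc v ^ 2 * r / (y * (1 + y ^ 4))
      ≤ (2 * (v - u / y) ^ 2 + 2 * (u / y) ^ 2) * r / (y * (1 + y ^ 4)) := by gcongr
    _ = 2 * (v - u / y) ^ 2 * r * (1 / (y * (1 + y ^ 4))) +
        2 * (u ^ 2 * r / (y ^ 3 * (1 + y ^ 4))) := by field_simp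
    _ ≤ 2 * (v - u / y) ^ 2 * r * (1 / y ^ 5) + 2 * (u ^ 2 * r / (y ^ 3 * (1 + y ^ 4))) := by
        gcongr
    _ = _ := by ring

theorem sq_second_deriv_le {y r u v a F : ℝ} (hy : 0 < y) (hr : 0 < r)
    (hF : F + 8 * u / (1 + y ^ 2) ^ 2 = -a - v / y + u / y ^ 2) :
    a ^ 2 * r / y ^ 3 ≤ 4 * (F ^ 2 * r / y ^ 3) +
      256 * (u ^ 2 * r / (y ^ 3 * (1 + y ^ 4) ^ 2)) + 2 * ((v - u / y) ^ 2 * r / y ^ 5) := by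
  have h1 := sq_add_potential_le (F := F) (u := u) hy hr
  set G := F + 8 * u / (1 + y ^ 2) ^ 2
  have ha : a = -G - (v - u / y) / y := by rw [hF]; field_simp; ring
  have h2 : a ^ 2 ≤ 2 * G ^ 2 + 2 * ((v - u / y) / y) ^ 2 := by
    rw [ha]; nlinarith [sq_nonneg (G - (v - u / y) / y)]
  calc a ^ 2 * r / y ^ 3 ≤ (2 * G ^ 2 + 2 * ((v - u / y) / y) ^ 2) * r / y ^ 3 := by gcongr
    _ = 2 * (G ^ 2 * r / y ^ 3) + 2 * ((v - u / y) ^ 2 * r / y ^ 5) := by field_simp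
    _ ≤ _ := by linarith

theorem sq_deriv_potential_le {y r u v F' : ℝ} (hy : 0 < y) (hr : 0 < r) :
    (F' + 8 * v / (1 + y ^ 2) ^ 2 - 32 * y * u / (1 + y ^ 2) ^ 3) ^ 2 * r / y ≤
      3 * (F' ^ 2 * r / y) + 192 * (v ^ 2 * r / (y * (1 + y ^ 4))) +
        3072 * (u ^ 2 * r / (y ^ 3 * (1 + y ^ 4))) := by
  have hs : (1 : ℝ) ≤ 1 + y ^ 2 := by nlinarith [sq_nonneg y]
  have hs2 : 1 + y ^ 4 ≤ (1 + y ^ 2) ^ 2 := by nlinarith [sq_nonneg y]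
  have h1 : (v / (1 + y ^ 2) ^ 2) ^ 2 ≤ v ^ 2 / (1 + y ^ 4) := by
    rw [div_pow]
    gcongr
    calc 1 + y ^ 4 ≤ (1 + y ^ 2) ^ 2 := hs2
      _ ≤ _ := le_self_pow₀ (one_le_pow₀ hs) (by norm_num)
  have h2 : (y * u / (1 + y ^ 2) ^ 3) ^ 2 ≤ u ^ 2 / (y ^ 2 * (1 + y ^ 4)) := by
    rw [div_pow, div_le_div_iff₀ (by positivity) (by positivity)]
    have h3 : y ^ 4 * (1 + y ^ 4) ≤ ((1 + y ^ 2) ^ 3) ^ 2 := by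
      calc y ^ 4 * (1 + y ^ 4) ≤ (1 + y ^ 2) ^ 2 * (1 + y ^ 2) ^ 2 := by
            gcongr; linarith
        _ = (1 + y ^ 2) ^ 4 := by ring
        _ ≤ (1 + y ^ 2) ^ 6 := pow_le_pow_right₀ hs (by norm_num)
        _ = _ := by ring
    calc (y * u) ^ 2 * (y ^ 2 * (1 + y ^ 4)) = u ^ 2 * (y ^ 4 * (1 + y ^ 4)) := by ring
      _ ≤ _ := by gcongr
  have h4 : (F' + 8 * v / (1 + y ^ 2) ^ 2 - 32 * y * u / (1 + y ^ 2) ^ 3) ^ 2 ≤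
      3 * F' ^ 2 + 192 * (v ^ 2 / (1 + y ^ 4)) + 3072 * (u ^ 2 / (y ^ 2 * (1 + y ^ 4))) := by
    rw [mul_div_assoc, mul_assoc, mul_div_assoc]
    set X := v / (1 + y ^ 2) ^ 2
    set Y := y * u / (1 + y ^ 2) ^ 3
    nlinarith [sq_nonneg (F' - 8 * X), sq_nonneg (F' + 32 * Y), sq_nonneg (8 * X + 32 * Y)]
  calc _ ≤ (3 * F' ^ 2 + 192 * (v ^ 2 / (1 + y ^ 4)) +
        3072 * (u ^ 2 / (y ^ 2 * (1 + y ^ 4)))) * r / y := by gcongr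
    _ = _ := by field_simp

theorem sq_third_deriv_le {y r u v a b F F' : ℝ} (hy : 0 < y) (hr : 0 < r)
    (hF : F + 8 * u / (1 + y ^ 2) ^ 2 = -a - v / y + u / y ^ 2)
    (hF' : F' + 8 * v / (1 + y ^ 2) ^ 2 - 32 * y * u / (1 + y ^ 2) ^ 3 =
      -b - a / y + 2 * v / y ^ 2 - 2 * u / y ^ 3) :
    b ^ 2 * r / y ≤ 9 * (F' ^ 2 * r / y) + 6 * (F ^ 2 * r / y ^ 3) +
      384 * (u ^ 2 * r / (y ^ 3 * (1 + y ^ 4) ^ 2)) + 1179 * ((v - u / y) ^ 2 * r / y ^ 5) +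
        10368 * (u ^ 2 * r / (y ^ 3 * (1 + y ^ 4))) := by
  have h1 := sq_add_potential_le (F := F) (u := u) hy hr
  have h2 := sq_deriv_potential_le (F' := F') (u := u) (v := v) hy hr
  have h3 := sq_div_le_of_sub_div (u := u) (v := v) hy hr
  set G := F + 8 * u / (1 + y ^ 2) ^ 2
  set G' := F' + 8 * v / (1 + y ^ 2) ^ 2 - 32 * y * u / (1 + y ^ 2) ^ 3
  have hb : b = -G' + G / y + 3 * ((v - u / y) / y ^ 2) := by rw [hF, hF']; field_simp; ring
  have h4 : b ^ 2 ≤ 3 * G' ^ 2 + 3 * (G / y) ^ 2 + 27 * ((v - u / y) / y ^ 2) ^ 2 := by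
    rw [hb]
    set X := G / y
    set Y := (v - u / y) / y ^ 2
    nlinarith [sq_nonneg (G' + X), sq_nonneg (G' + 3 * Y), sq_nonneg (X - 3 * Y)]
  calc b ^ 2 * r / y
      ≤ (3 * G' ^ 2 + 3 * (G / y) ^ 2 + 27 * ((v - u / y) / y ^ 2) ^ 2) * r / y := by gcongr
    _ = 3 * (G' ^ 2 * r / y) + 3 * (G ^ 2 * r / y ^ 3) + 27 * ((v - u / y) ^ 2 * r / y ^ 5) := by
        field_simp
    _ ≤ _ := by linarith

/-! ### Integral estimates -/

section IntegralEstimates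

variable {u v : ℝ → ℝ}

theorem continuousOn_Ioi_zero_of_hasDerivAt {f f' : ℝ → ℝ} (h : ∀ y > 0, HasDerivAt f (f' y) y) :
    ContinuousOn f (Ioi 0) := fun y hy => (h y hy).continuousAt.continuousWithinAt

theorem hasDerivAt_div_id (hu : ∀ y > 0, HasDerivAt u (v y) y) {y : ℝ} (hy : 0 < y) :
    HasDerivAt (fun z => u z / z) ((v y - u y / y) / y) y := by
  refine ((hu y hy).div (hasDerivAt_id y) hy.ne').congr_deriv ?_
  simp only [id]
  field_simp

theorem hasDerivAt_sub_div_id {a : ℝ → ℝ} (hu : ∀ y > 0, HasDerivAt u (v y) y)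
    (hv : ∀ y > 0, HasDerivAt v (a y) y) {y : ℝ} (hy : 0 < y) :
    HasDerivAt (fun z => v z - u z / z)
      (-(-a y - v y / y + u y / y ^ 2) - 2 * (v y - u y / y) / y) y := by
  refine ((hv y hy).sub (hasDerivAt_div_id hu hy)).congr_deriv ?_
  field_simp; ring

theorem integral_sub_div_id_le {a F : ℝ → ℝ} (hu : ∀ y > 0, HasDerivAt u (v y) y)
    (hv : ∀ y > 0, HasDerivAt v (a y) y)
    (hF : ∀ y > 0, F y + 8 * u y / (1 + y ^ 2) ^ 2 = -a y - v y / y + u y / y ^ 2)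
    (hA : IntegrableOn (fun y => F y ^ 2 * logWeight y / y ^ 3) (Ioi 0))
    (hE : IntegrableOn (fun y => u y ^ 2 * logWeight y / (y ^ 3 * (1 + y ^ 4) ^ 2)) (Ioi 0))
    (hQ : IntegrableOn
      (fun y => (v y - u y / y) ^ 2 * logWeight y / (1 + y ^ 4) / y) (Ioi 0)) :
    IntegrableOn (fun y => (v y - u y / y) ^ 2 * logWeight y / y ^ 5) (Ioi 0) ∧
      ∫ y in Ioi 0, (v y - u y / y) ^ 2 * logWeight y / y ^ 5 ≤
        16 * (∫ y in Ioi 0, F y ^ 2 * logWeight y / y ^ 3) +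
          1024 * ∫ y in Ioi 0, u y ^ 2 * logWeight y / (y ^ 3 * (1 + y ^ 4) ^ 2) := by
  have cu := continuousOn_Ioi_zero_of_hasDerivAt hu
  have cv := continuousOn_Ioi_zero_of_hasDerivAt hv
  have cr := continuousOn_logWeight
  have hAE := (hA.const_mul 2).add (hE.const_mul 128)
  have hAE' : ∫ y in Ioi 0, (2 * (F y ^ 2 * logWeight y / y ^ 3) +
      128 * (u y ^ 2 * logWeight y / (y ^ 3 * (1 + y ^ 4) ^ 2))) =
      2 * (∫ y in Ioi 0, F y ^ 2 * logWeight y / y ^ 3) +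
        128 * ∫ y in Ioi 0, u y ^ 2 * logWeight y / (y ^ 3 * (1 + y ^ 4) ^ 2) := by
    rw [integral_add (hA.const_mul 2) (hE.const_mul 128), integral_const_mul, integral_const_mul]
  have reg : ∀ η > 0,
      IntegrableOn (fun y => 2 * (v y - u y / y) ^ 2 * logWeight y * (1 / (y + η) ^ 4) / y)
        (Ioi 0) ∧
      ∫ y in Ioi 0, 2 * (v y - u y / y) ^ 2 * logWeight y * (1 / (y + η) ^ 4) / y ≤
        2 * (∫ y in Ioi 0, F y ^ 2 * logWeight y / y ^ 3) +
          128 * ∫ y in Ioi 0, u y ^ 2 * logWeight y / (y ^ 3 * (1 + y ^ 4) ^ 2) := by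
    intro η hη
    rw [← hAE']
    have hk : ∀ y > 0, HasDerivAt (fun z => 1 / (z + η) ^ 4) (-(4 / (y + η) ^ 5)) y := by
      intro y hy
      have hne : (y + η) ^ 4 ≠ 0 := by positivity
      refine ((((hasDerivAt_id y).add_const η).pow 4).inv hne |>.congr_of_eventuallyEq
        (Eventually.of_forall fun z => ?_)).congr_deriv ?_
      · simp
      · simp; field_simp
    refine integrableOn_Ioi_zero_of_add_deriv_le
      (Φ := fun y => (v y - u y / y) ^ 2 * (logWeight y * (1 / (y + η) ^ 4))) ?_ ?_ hAE ?_
      (fun y hy => (((hasDerivAt_sub_div_id hu hv hy).pow 2).mul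
        ((hasDerivAt_logWeight hy).mul (hk y hy)))) ?_ ?_ ?_
    · fun_prop (disch := intro y hy; have : 0 < y := hy; positivity)
    · intro y hy
      have := logWeight_pos y
      positivity
    · intro y hy
      have := logWeight_pos y
      positivity
    · intro y hy
      have hr := logWeight_pos y
      have h1 := energy_deriv_le (p := v y - u y / y) (G := -a y - v y / y + u y / y ^ 2)
        (k := 1 / (y + η) ^ 4) (k' := -(4 / (y + η) ^ 5)) hy hr (by positivity)
        (by gcongr; linarith) (abs_deriv_logWeight_le hy)
        (neg_nonpos.2 (by positivity))
      have h2 := sq_add_potential_le (F := F y) (u := u y) hy hr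
      rw [hF y hy] at h2
      simp only [Pi.mul_apply, Pi.pow_apply]
      norm_num at h1 h2 ⊢
      linarith
    · intro ε hε b hb
      obtain ⟨x, hx0, hxb, hx⟩ := exists_lt_le_of_integrableOn_div hQ
        (by positivity : 0 < ε * η ^ 4 / 2) (lt_min hb one_pos)
      refine ⟨x, hx0, hxb.trans_le (min_le_left _ _), ?_⟩
      have hx1 : x ^ 4 ≤ 1 := pow_le_one₀ hx0.le (hxb.le.trans (min_le_right _ _))
      have hr := logWeight_pos x
      rw [div_le_iff₀ (by positivity)] at hx
      have : 1 / (x + η) ^ 4 ≤ 1 / η ^ 4 := by gcongr; linarith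
      calc (v x - u x / x) ^ 2 * (logWeight x * (1 / (x + η) ^ 4))
          = (v x - u x / x) ^ 2 * logWeight x * (1 / (x + η) ^ 4) := by ring
        _ ≤ ε * η ^ 4 / 2 * (1 + x ^ 4) * (1 / η ^ 4) := by gcongr
        _ = ε * ((1 + x ^ 4) / 2) := by field_simp
        _ ≤ ε * 1 := by gcongr; linarith
        _ = ε := mul_one ε
    · intro ε hε b hb
      refine ⟨b + 1, by linarith, ?_⟩
      have hr := logWeight_pos (b + 1)
      have : 0 ≤ (v (b + 1) - u (b + 1) / (b + 1)) ^ 2 *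
        (logWeight (b + 1) * (1 / (b + 1 + η) ^ 4)) := by positivity
      linarith
  refine integrableOn_Ioi_zero_of_setIntegral_Icc_le ?_ ?_ ?_
  · fun_prop (disch := intro y hy; have : 0 < y := hy; positivity)
  · intro y hy
    have := logWeight_pos y
    positivity
  intro b c hb _
  obtain ⟨hi, hle⟩ := reg b hb
  have hsub : Icc b c ⊆ Ioi 0 := fun y hy => hb.trans_le hy.1
  have h1 : ∫ y in Icc b c, (v y - u y / y) ^ 2 * logWeight y / y ^ 5 ≤
      ∫ y in Icc b c, 8 * (2 * (v y - u y / y) ^ 2 * logWeight y * (1 / (y + b) ^ 4) / y) := by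
    refine setIntegral_mono_on (ContinuousOn.integrableOn_Icc (ContinuousOn.mono ?_ hsub))
      (IntegrableOn.mono_set (hi.const_mul 8) hsub) measurableSet_Icc fun y hy => ?_
    · fun_prop (disch := intro y hy; have : 0 < y := hy; positivity)
    · have hy0 : 0 < y := hsub hy
      have hr := logWeight_pos y
      have : 1 / y ^ 4 ≤ 16 * (1 / (y + b) ^ 4) := by
        rw [mul_one_div, div_le_div_iff₀ (by positivity) (by positivity)]
        have : (y + b) ^ 4 ≤ (2 * y) ^ 4 := by
          have := hy.1
          gcongr; linarith
        calc 1 * (y + b) ^ 4 ≤ (2 * y) ^ 4 := by linarith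
          _ = _ := by ring
      calc (v y - u y / y) ^ 2 * logWeight y / y ^ 5
          = (v y - u y / y) ^ 2 * logWeight y * (1 / y ^ 4) / y := by field_simp
        _ ≤ (v y - u y / y) ^ 2 * logWeight y * (16 * (1 / (y + b) ^ 4)) / y := by gcongr
        _ = _ := by ring
  have h2 : ∫ y in Icc b c, 8 * (2 * (v y - u y / y) ^ 2 * logWeight y * (1 / (y + b) ^ 4) / y) ≤
      ∫ y in Ioi 0, 8 * (2 * (v y - u y / y) ^ 2 * logWeight y * (1 / (y + b) ^ 4) / y) := by
    refine setIntegral_mono_set (hi.const_mul 8) ((ae_restrict_iff' measurableSet_Ioi).2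
      (Eventually.of_forall fun y (hy : 0 < y) => ?_)) hsub.eventuallyLE
    have := logWeight_pos y
    simp only [Pi.zero_apply]
    positivity
  rw [integral_const_mul _ (fun y => 2 * (v y - u y / y) ^ 2 * logWeight y * (1 / (y + b) ^ 4) / y)]
    at h1 h2
  rw [integral_const_mul] at h2
  linarith

theorem integral_cutoff_le {ε C : ℝ} (hε : 0 < ε) (hC : 0 ≤ C)
    (hc : ∀ y > 0, 32 / (logWeight y * y * (1 + y ^ 4) ^ 2) ≤
      ε * (logWeight y / y ^ 5) + C * (y ^ 3 / (1 + y ^ 10)))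
    (hu : ∀ y > 0, HasDerivAt u (v y) y)
    (hT : IntegrableOn (fun y => u y ^ 2 * logWeight y / (y ^ 3 * (1 + y ^ 4))) (Ioi 0))
    (hP : IntegrableOn (fun y => (v y - u y / y) ^ 2 * logWeight y / y ^ 5) (Ioi 0))
    (hL : IntegrableOn (fun y => v y ^ 2 * y / (1 + y ^ 8) + u y ^ 2 * y / (1 + y ^ 10))
      (Ioi 0)) :
    ∫ y in Ioi 0, u y ^ 2 * logWeight y / (y ^ 3 * (1 + y ^ 4) ^ 2) / 2 ≤
      ε * (∫ y in Ioi 0, (v y - u y / y) ^ 2 * logWeight y / y ^ 5) +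
        (4 * C + 64) *
          ∫ y in Ioi 0, (v y ^ 2 * y / (1 + y ^ 8) + u y ^ 2 * y / (1 + y ^ 10)) := by
  have cu := continuousOn_Ioi_zero_of_hasDerivAt hu
  have cr := continuousOn_logWeight
  rw [← integral_const_mul, ← integral_const_mul,
    ← integral_add (hP.const_mul ε) (hL.const_mul (4 * C + 64))]
  have hθ : ∀ y > 0, HasDerivAt (fun z => π / 2 + arctan (log z)) (logWeight y / y) y := by
    intro y hy
    refine (((hasDerivAt_log hy.ne').arctan).const_add (π / 2)).congr_deriv ?_
    unfold logWeight; field_simp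
  have hχ : ∀ y > 0, HasDerivAt (fun z : ℝ => 1 / (1 + z ^ 4) ^ 2)
      (-(8 * y ^ 3 / (1 + y ^ 4) ^ 3)) y := by
    intro y hy
    have hne : (1 + y ^ 4) ^ 2 ≠ 0 := by positivity
    refine ((((hasDerivAt_pow 4 y).const_add 1).pow 2).inv hne |>.congr_of_eventuallyEq
      (Eventually.of_forall fun z => ?_)).congr_deriv ?_
    · simp
    · simp; field_simp; ring
  have hθ0 : ∀ y, 0 ≤ π / 2 + arctan (log y) := fun y => by
    linarith [neg_pi_div_two_lt_arctan (log y)]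
  have hθ4 : ∀ y, π / 2 + arctan (log y) ≤ 4 := fun y => by
    linarith [arctan_lt_pi_div_two (log y), pi_le_four]
  refine (integrableOn_Ioi_zero_of_add_deriv_le
    (Φ := fun y => -((u y / y) ^ 2 * ((π / 2 + arctan (log y)) * (1 / (1 + y ^ 4) ^ 2))))
    ?_ ?_ ((hP.const_mul ε).add (hL.const_mul (4 * C + 64))) ?_
    (fun y hy => (((hasDerivAt_div_id hu hy).pow 2).mul ((hθ y hy).mul (hχ y hy))).neg)
    ?_ ?_ ?_).2
  · fun_prop (disch := intro y hy; have : 0 < y := hy; positivity)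
  · intro y hy
    have := logWeight_pos y
    positivity
  · intro y hy
    have := logWeight_pos y
    simp only [Pi.add_apply]
    positivity
  · intro y hy
    have h1 := cutoff_deriv_le (u := u y) (v := v y) hy (logWeight_pos y) hC (hθ0 y) (hθ4 y)
      (hc y hy)
    simp only [Pi.add_apply, Pi.mul_apply, Pi.pow_apply]
    norm_num at h1 ⊢
    linarith
  · intro δ hδ b hb
    refine ⟨b / 2, by linarith, by linarith, ?_⟩
    have := hθ0 (b / 2)
    have : 0 ≤ (u (b / 2) / (b / 2)) ^ 2 *
      ((π / 2 + arctan (log (b / 2))) * (1 / (1 + (b / 2) ^ 4) ^ 2)) := by positivity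
    linarith
  · intro δ hδ b hb
    have hT' : IntegrableOn (fun y => (u y / y) ^ 2 * logWeight y / (1 + y ^ 4) / y) (Ioi 0) :=
      hT.congr_fun (fun y (hy : 0 < y) => by simp only; field_simp) measurableSet_Ioi
    obtain ⟨x, hxb, hx⟩ := exists_gt_le_of_integrableOn_div hT'
      (by positivity : 0 < δ / 40) (lt_max_of_lt_left hb : 0 < max b 1)
    have hx1 : 1 ≤ x := (le_max_right _ _).trans hxb.le
    have hx0 : 0 < x := by linarith
    refine ⟨x, (le_max_left _ _).trans_lt hxb, neg_le_neg ?_⟩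
    have hr := logWeight_pos x
    have h1 : 1 ≤ logWeight x * (10 * (1 + x ^ 4)) := by
      refine (one_le_logWeight_mul hx0).trans ?_
      have h2 : 1 / x ≤ x := by rw [div_le_iff₀ hx0]; nlinarith
      have h3 : x ≤ x ^ 4 := le_self_pow₀ hx1 (by norm_num)
      exact mul_le_mul_of_nonneg_left (by linarith) hr.le
    calc (u x / x) ^ 2 * ((π / 2 + arctan (log x)) * (1 / (1 + x ^ 4) ^ 2))
        ≤ (u x / x) ^ 2 * (4 * ((logWeight x * (10 * (1 + x ^ 4))) / (1 + x ^ 4) ^ 2)) := by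
          gcongr
          exact hθ4 x
      _ = 40 * ((u x / x) ^ 2 * logWeight x / (1 + x ^ 4)) := by field_simp; ring
      _ ≤ 40 * (δ / 40) := by gcongr
      _ = δ := by ring

theorem integral_hardy_le (hu : ∀ y > 0, HasDerivAt u (v y) y)
    (hT : IntegrableOn (fun y => u y ^ 2 * logWeight y / (y ^ 3 * (1 + y ^ 4))) (Ioi 0))
    (hE : IntegrableOn (fun y => u y ^ 2 * logWeight y / (y ^ 3 * (1 + y ^ 4) ^ 2)) (Ioi 0))
    (hP : IntegrableOn (fun y => (v y - u y / y) ^ 2 * logWeight y / y ^ 5) (Ioi 0)) :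
    ∫ y in Ioi 0, u y ^ 2 * logWeight y / (y ^ 3 * (1 + y ^ 4)) / 2 ≤
      8 * (∫ y in Ioi 0, u y ^ 2 * logWeight y / (y ^ 3 * (1 + y ^ 4) ^ 2)) +
        2 * ∫ y in Ioi 0, (v y - u y / y) ^ 2 * logWeight y / y ^ 5 := by
  have cu := continuousOn_Ioi_zero_of_hasDerivAt hu
  have cr := continuousOn_logWeight
  rw [← integral_const_mul, ← integral_const_mul,
    ← integral_add (hE.const_mul 8) (hP.const_mul 2)]
  have hκ : ∀ y > 0, HasDerivAt (fun z : ℝ => z ^ 4 / (1 + z ^ 4) ^ 2)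
      ((4 * y ^ 3 - 4 * y ^ 7) / (1 + y ^ 4) ^ 3) y := by
    intro y hy
    have hne : (1 + y ^ 4) ^ 2 ≠ 0 := by positivity
    refine ((hasDerivAt_pow 4 y).div (((hasDerivAt_pow 4 y).const_add 1).pow 2)
      hne).congr_deriv ?_
    simp; field_simp; ring
  refine (integrableOn_Ioi_zero_of_add_deriv_le
    (Φ := fun y => (u y / y) ^ 2 * (logWeight y * (y ^ 4 / (1 + y ^ 4) ^ 2)))
    ?_ ?_ ((hE.const_mul 8).add (hP.const_mul 2)) ?_
    (fun y hy => (((hasDerivAt_div_id hu hy).pow 2).mul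
      ((hasDerivAt_logWeight hy).mul (hκ y hy)))) ?_ ?_ ?_).2
  · fun_prop (disch := intro y hy; have : 0 < y := hy; positivity)
  · intro y hy
    have := logWeight_pos y
    positivity
  · intro y hy
    have := logWeight_pos y
    simp only [Pi.add_apply]
    positivity
  · intro y hy
    have h1 := hardy_deriv_le (u := u y) (v := v y) hy (logWeight_pos y)
      (abs_deriv_logWeight_le hy)
    simp only [Pi.add_apply, Pi.mul_apply, Pi.pow_apply]
    norm_num at h1 ⊢
    linarith
  · intro δ hδ b hb
    have hT' : IntegrableOn (fun y => (u y / y) ^ 2 * logWeight y / (1 + y ^ 4) / y) (Ioi 0) :=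
      hT.congr_fun (fun y (hy : 0 < y) => by simp only; field_simp) measurableSet_Ioi
    obtain ⟨x, hx0, hxb, hx⟩ := exists_lt_le_of_integrableOn_div hT' hδ hb
    refine ⟨x, hx0, hxb, le_trans ?_ hx⟩
    have hr := logWeight_pos x
    calc (u x / x) ^ 2 * (logWeight x * (x ^ 4 / (1 + x ^ 4) ^ 2))
        ≤ (u x / x) ^ 2 * (logWeight x * ((1 + x ^ 4) / (1 + x ^ 4) ^ 2)) := by
          gcongr; linarith
      _ = _ := by field_simp
  · intro δ hδ b hb
    refine ⟨b + 1, by linarith, ?_⟩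
    have hr := logWeight_pos (b + 1)
    have : 0 ≤ (u (b + 1) / (b + 1)) ^ 2 *
      (logWeight (b + 1) * ((b + 1) ^ 4 / (1 + (b + 1) ^ 4) ^ 2)) := by positivity
    linarith

end IntegralEstimates

theorem Hop_add_potential (u : ℝ → ℝ) {y : ℝ} (hy : 0 < y) :
    Hop u y + 8 * u y / (1 + y ^ 2) ^ 2 =
      -deriv (deriv u) y - deriv u y / y + u y / y ^ 2 := by
  unfold Hop Vfun
  field_simp
  ring

theorem deriv_Hop_add {u v a b : ℝ → ℝ} (hv : deriv u = v) (ha : deriv v = a)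
    (hu1 : ∀ y > 0, HasDerivAt u (v y) y) (hu2 : ∀ y > 0, HasDerivAt v (a y) y)
    (hu3 : ∀ y > 0, HasDerivAt a (b y) y) {y : ℝ} (hy : 0 < y) :
    deriv (Hop u) y + 8 * v y / (1 + y ^ 2) ^ 2 - 32 * y * u y / (1 + y ^ 2) ^ 3 =
      -b y - a y / y + 2 * v y / y ^ 2 - 2 * u y / y ^ 3 := by
  have hne : (1 + y ^ 2) ^ 2 ≠ 0 := by positivity
  have h1 := ((hu3 y hy).neg.sub ((hu2 y hy).div (hasDerivAt_id y) hy.ne')).add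
    ((hu1 y hy).div (hasDerivAt_pow 2 y) (by positivity))
  have h2 := (((hu1 y hy).const_mul 8).div (((hasDerivAt_pow 2 y).const_add 1).pow 2) hne)
  have h3 : Hop u =ᶠ[𝓝 y] (-a - v / id + u / fun x => x ^ 2) -
      (fun y => 8 * u y) / (fun x => 1 + x ^ 2) ^ 2 := by
    filter_upwards [Ioi_mem_nhds hy] with z hz
    have := Hop_add_potential u hz
    rw [hv, ha] at this
    simp only [Pi.sub_apply, Pi.add_apply, Pi.neg_apply, Pi.div_apply, Pi.pow_apply, id]
    linarith
  rw [((h1.sub h2).congr_of_eventuallyEq h3).deriv]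
  simp
  field_simp
  ring

theorem sq_mul_logWeight_div_le {x y d e : ℝ} (hy : 0 < y) (hd : 0 < d) (he : e = d * y) :
    x ^ 2 * logWeight y / d ≤ 2 * (x ^ 2 / (e * (1 + |log y|) ^ 2) * y) := by
  have h := mul_le_mul_of_nonneg_left (logWeight_le y) (show 0 ≤ x ^ 2 / d by positivity)
  subst he
  calc x ^ 2 * logWeight y / d = x ^ 2 / d * logWeight y := by ring
    _ ≤ x ^ 2 / d * (2 * (1 / (1 + |log y|) ^ 2)) := h
    _ = _ := by field_simp

theorem sq_div_le_logWeight_div {x y d e : ℝ} (hy : 0 < y) (hd : 0 < d) (he : e = d * y) :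
    x ^ 2 / (e * (1 + |log y|) ^ 2) * y ≤ x ^ 2 * logWeight y / d := by
  have h := mul_le_mul_of_nonneg_left (inv_sq_le_logWeight y) (show 0 ≤ x ^ 2 / d by positivity)
  subst he
  calc x ^ 2 / (d * y * (1 + |log y|) ^ 2) * y = x ^ 2 / d * (1 / (1 + |log y|) ^ 2) := by
        field_simp
    _ ≤ x ^ 2 / d * logWeight y := h
    _ = _ := by ring

theorem one_le_logWeight_div_mul {y : ℝ} (hy : 0 < y) :
    1 ≤ logWeight y / y * (5 * (1 + y ^ 2)) := by
  refine (one_le_logWeight_mul hy).trans_eq ?_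
  field_simp
  ring

theorem integrableOn_sub_div_id {u v : ℝ → ℝ} (cu : ContinuousOn u (Ioi 0))
    (cv : ContinuousOn v (Ioi 0))
    (hT : IntegrableOn (fun y => u y ^ 2 * logWeight y / (y ^ 3 * (1 + y ^ 4))) (Ioi 0))
    (hV : IntegrableOn (fun y => v y ^ 2 * logWeight y / (y * (1 + y ^ 4))) (Ioi 0)) :
    IntegrableOn (fun y => (v y - u y / y) ^ 2 * logWeight y / (1 + y ^ 4) / y) (Ioi 0) := by
  have cr := continuousOn_logWeight
  refine integrableOn_Ioi_zero_of_le
    (by fun_prop (disch := intro y hy; have : 0 < y := hy; positivity))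
    (fun y hy => by have := logWeight_pos y; positivity) ((hV.const_mul 2).add (hT.const_mul 2))
    fun y hy => ?_
  have hr := logWeight_pos y
  have h1 : (v y - u y / y) ^ 2 ≤ 2 * v y ^ 2 + 2 * (u y / y) ^ 2 := by
    nlinarith [sq_nonneg (v y + u y / y)]
  calc (v y - u y / y) ^ 2 * logWeight y / (1 + y ^ 4) / y
      ≤ (2 * v y ^ 2 + 2 * (u y / y) ^ 2) * logWeight y / (1 + y ^ 4) / y := by gcongr
    _ = 2 * (v y ^ 2 * logWeight y / (y * (1 + y ^ 4))) +
        2 * (u y ^ 2 * logWeight y / (y ^ 3 * (1 + y ^ 4))) := by field_simp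

theorem integrableOn_sq_div_one_add_pow_eight {v : ℝ → ℝ} (cv : ContinuousOn v (Ioi 0))
    (hV : IntegrableOn (fun y => v y ^ 2 * logWeight y / (y * (1 + y ^ 4))) (Ioi 0)) :
    IntegrableOn (fun y => v y ^ 2 / (1 + y ^ 8) * y) (Ioi 0) := by
  have cr := continuousOn_logWeight
  refine integrableOn_Ioi_zero_of_le
    (by fun_prop (disch := intro y hy; have : 0 < y := hy; positivity))
    (fun y hy => by positivity) (hV.const_mul 20) fun y hy => ?_
  have hr := logWeight_pos y
  have h2 : y * (1 + y ^ 2) * (1 + y ^ 4) ≤ 4 * (1 + y ^ 8) := by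
    linarith [pow_le_one_add_pow hy.le (show 1 ≤ 8 by norm_num),
      pow_le_one_add_pow hy.le (show 3 ≤ 8 by norm_num),
      pow_le_one_add_pow hy.le (show 5 ≤ 8 by norm_num),
      pow_le_one_add_pow hy.le (show 7 ≤ 8 by norm_num)]
  calc v y ^ 2 / (1 + y ^ 8) * y
      ≤ v y ^ 2 / (1 + y ^ 8) * y * (logWeight y / y * (5 * (1 + y ^ 2))) :=
        le_mul_of_one_le_right (by positivity) (one_le_logWeight_div_mul hy)
    _ = v y ^ 2 * logWeight y * 5 / (1 + y ^ 8) *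
        (y * (1 + y ^ 2) * (1 + y ^ 4)) / (y * (1 + y ^ 4)) := by field_simp
    _ ≤ v y ^ 2 * logWeight y * 5 / (1 + y ^ 8) *
        (4 * (1 + y ^ 8)) / (y * (1 + y ^ 4)) := by gcongr
    _ = _ := by field_simp; ring

theorem integrableOn_sq_div_one_add_pow_ten {u : ℝ → ℝ} (cu : ContinuousOn u (Ioi 0))
    (hT : IntegrableOn (fun y => u y ^ 2 * logWeight y / (y ^ 3 * (1 + y ^ 4))) (Ioi 0)) :
    IntegrableOn (fun y => u y ^ 2 / (1 + y ^ 10) * y) (Ioi 0) := by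
  have cr := continuousOn_logWeight
  refine integrableOn_Ioi_zero_of_le
    (by fun_prop (disch := intro y hy; have : 0 < y := hy; positivity))
    (fun y hy => by positivity) (hT.const_mul 20) fun y hy => ?_
  have hr := logWeight_pos y
  have h2 : y ^ 3 * (1 + y ^ 2) * (1 + y ^ 4) ≤ 4 * (1 + y ^ 10) := by
    linarith [pow_le_one_add_pow hy.le (show 3 ≤ 10 by norm_num),
      pow_le_one_add_pow hy.le (show 5 ≤ 10 by norm_num),
      pow_le_one_add_pow hy.le (show 7 ≤ 10 by norm_num),
      pow_le_one_add_pow hy.le (show 9 ≤ 10 by norm_num)]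
  calc u y ^ 2 / (1 + y ^ 10) * y
      ≤ u y ^ 2 / (1 + y ^ 10) * y * (logWeight y / y * (5 * (1 + y ^ 2))) :=
        le_mul_of_one_le_right (by positivity) (one_le_logWeight_div_mul hy)
    _ = u y ^ 2 * logWeight y * 5 / (1 + y ^ 10) *
        (y ^ 3 * (1 + y ^ 2) * (1 + y ^ 4)) / (y ^ 3 * (1 + y ^ 4)) := by field_simp
    _ ≤ u y ^ 2 * logWeight y * 5 / (1 + y ^ 10) *
        (4 * (1 + y ^ 10)) / (y ^ 3 * (1 + y ^ 4)) := by gcongr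
    _ = _ := by field_simp; ring

/-- The pointwise density that controls all four terms on the coercive side. -/
def controlDensity (u v F F' : ℝ → ℝ) (y : ℝ) : ℝ :=
  2 * (F y ^ 2 / (y ^ 4 * (1 + |log y|) ^ 2) * y) +
    2 * (F' y ^ 2 / (y ^ 2 * (1 + |log y|) ^ 2) * y) +
    (v y - u y / y) ^ 2 * logWeight y / y ^ 5 +
    u y ^ 2 * logWeight y / (y ^ 3 * (1 + y ^ 4))

theorem sq_mul_logWeight_div_sq_le (x : ℝ) {y : ℝ} (hy : 0 < y) :
    x ^ 2 * logWeight y / (y ^ 3 * (1 + y ^ 4) ^ 2) ≤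
      x ^ 2 * logWeight y / (y ^ 3 * (1 + y ^ 4)) := by
  have := logWeight_pos y
  gcongr
  exact le_self_pow₀ (by nlinarith [pow_pos hy 4]) (by norm_num)

theorem controlDensity_bounds {u v a b F F' : ℝ → ℝ} {y : ℝ} (hy : 0 < y)
    (hF : F y + 8 * u y / (1 + y ^ 2) ^ 2 = -a y - v y / y + u y / y ^ 2)
    (hF' : F' y + 8 * v y / (1 + y ^ 2) ^ 2 - 32 * y * u y / (1 + y ^ 2) ^ 3 =
      -b y - a y / y + 2 * v y / y ^ 2 - 2 * u y / y ^ 3) :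
    u y ^ 2 / (y ^ 4 * (1 + y ^ 4) * (1 + |log y|) ^ 2) * y ≤
        11000 * controlDensity u v F F' y ∧
      v y ^ 2 / (y ^ 2 * (1 + y ^ 4) * (1 + |log y|) ^ 2) * y ≤
        11000 * controlDensity u v F F' y ∧
      a y ^ 2 / (y ^ 4 * (1 + |log y|) ^ 2) * y ≤ 11000 * controlDensity u v F F' y ∧
      b y ^ 2 / (y ^ 2 * (1 + |log y|) ^ 2) * y ≤ 11000 * controlDensity u v F F' y := by
  have hr := logWeight_pos y
  have n1 : 0 ≤ F y ^ 2 / (y ^ 4 * (1 + |log y|) ^ 2) * y := by positivity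
  have n2 : 0 ≤ F' y ^ 2 / (y ^ 2 * (1 + |log y|) ^ 2) * y := by positivity
  have n3 : 0 ≤ (v y - u y / y) ^ 2 * logWeight y / y ^ 5 := by positivity
  have n4 : 0 ≤ u y ^ 2 * logWeight y / (y ^ 3 * (1 + y ^ 4)) := by positivity
  have l1 : F y ^ 2 * logWeight y / y ^ 3 ≤
      2 * (F y ^ 2 / (y ^ 4 * (1 + |log y|) ^ 2) * y) :=
    sq_mul_logWeight_div_le hy (by positivity) (by ring)
  have l2 : F' y ^ 2 * logWeight y / y ≤
      2 * (F' y ^ 2 / (y ^ 2 * (1 + |log y|) ^ 2) * y) :=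
    sq_mul_logWeight_div_le hy hy (by ring)
  have l3 := sq_mul_logWeight_div_sq_le (u y) hy
  have t0 : u y ^ 2 / (y ^ 4 * (1 + y ^ 4) * (1 + |log y|) ^ 2) * y ≤
      u y ^ 2 * logWeight y / (y ^ 3 * (1 + y ^ 4)) :=
    sq_div_le_logWeight_div hy (by positivity) (by ring)
  have t1 : v y ^ 2 / (y ^ 2 * (1 + y ^ 4) * (1 + |log y|) ^ 2) * y ≤
      v y ^ 2 * logWeight y / (y * (1 + y ^ 4)) :=
    sq_div_le_logWeight_div hy (by positivity) (by ring)
  have t2 : a y ^ 2 / (y ^ 4 * (1 + |log y|) ^ 2) * y ≤ a y ^ 2 * logWeight y / y ^ 3 :=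
    sq_div_le_logWeight_div hy (by positivity) (by ring)
  have t3 : b y ^ 2 / (y ^ 2 * (1 + |log y|) ^ 2) * y ≤ b y ^ 2 * logWeight y / y :=
    sq_div_le_logWeight_div hy hy (by ring)
  have s1 := sq_div_le_of_sub_div (u := u y) (v := v y) hy hr
  have s2 := sq_second_deriv_le hy hr hF
  have s3 := sq_third_deriv_le hy hr hF hF'
  unfold controlDensity
  refine ⟨?_, ?_, ?_, ?_⟩ <;> linarith

theorem exists_subcoercivity_constants : ∃ c C : ℝ, 0 < c ∧ 0 < C ∧
    ∀ u v a b F F' : ℝ → ℝ, (∀ y > 0, HasDerivAt u (v y) y) → (∀ y > 0, HasDerivAt v (a y) y) →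
      ContinuousOn F (Ioi 0) →
      (∀ y > 0, F y + 8 * u y / (1 + y ^ 2) ^ 2 = -a y - v y / y + u y / y ^ 2) →
      (∀ y > 0, F' y + 8 * v y / (1 + y ^ 2) ^ 2 - 32 * y * u y / (1 + y ^ 2) ^ 3 =
        -b y - a y / y + 2 * v y / y ^ 2 - 2 * u y / y ^ 3) →
      IntegrableOn (fun y => F y ^ 2 / (y ^ 4 * (1 + |log y|) ^ 2) * y) (Ioi 0) →
      IntegrableOn (fun y => F' y ^ 2 / (y ^ 2 * (1 + |log y|) ^ 2) * y) (Ioi 0) →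
      IntegrableOn (fun y => u y ^ 2 / (y ^ 4 * (1 + y ^ 4) * (1 + |log y|) ^ 2) * y) (Ioi 0) →
      IntegrableOn (fun y => v y ^ 2 / (y ^ 2 * (1 + y ^ 4) * (1 + |log y|) ^ 2) * y) (Ioi 0) →
      c * ((∫ y in Ioi (0 : ℝ), u y ^ 2 / (y ^ 4 * (1 + y ^ 4) * (1 + |log y|) ^ 2) * y) +
          (∫ y in Ioi (0 : ℝ), v y ^ 2 / (y ^ 2 * (1 + y ^ 4) * (1 + |log y|) ^ 2) * y) +
          (∫ y in Ioi (0 : ℝ), a y ^ 2 / (y ^ 4 * (1 + |log y|) ^ 2) * y) +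
          ∫ y in Ioi (0 : ℝ), b y ^ 2 / (y ^ 2 * (1 + |log y|) ^ 2) * y) -
        C * ((∫ y in Ioi (0 : ℝ), v y ^ 2 / (1 + y ^ 8) * y) +
          ∫ y in Ioi (0 : ℝ), u y ^ 2 / (1 + y ^ 10) * y) ≤
      (∫ y in Ioi (0 : ℝ), F y ^ 2 / (y ^ 4 * (1 + |log y|) ^ 2) * y) +
        ∫ y in Ioi (0 : ℝ), F' y ^ 2 / (y ^ 2 * (1 + |log y|) ^ 2) * y := by
  obtain ⟨M, hM, hc⟩ := exists_cross_coeff_le (ε := 1 / 4096) (by norm_num)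
  refine ⟨1 / 20000000, 100 * (4 * M + 64), by norm_num, by positivity, ?_⟩
  intro u v a b F F' d1 d2 cF hF hF' hA0 hA1 hT0 hV0
  have cu := continuousOn_Ioi_zero_of_hasDerivAt d1
  have cv := continuousOn_Ioi_zero_of_hasDerivAt d2
  have cr := continuousOn_logWeight
  have rpos := logWeight_pos
  have leA : ∀ y > 0, F y ^ 2 * logWeight y / y ^ 3 ≤
      2 * (F y ^ 2 / (y ^ 4 * (1 + |log y|) ^ 2) * y) := fun y hy =>
    sq_mul_logWeight_div_le hy (by positivity) (by ring)
  have hA : IntegrableOn (fun y => F y ^ 2 * logWeight y / y ^ 3) (Ioi 0) :=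
    integrableOn_Ioi_zero_of_le
      (by fun_prop (disch := intro y hy; have : 0 < y := hy; positivity))
      (fun y hy => by have := rpos y; positivity) (hA0.const_mul 2) leA
  have hT : IntegrableOn (fun y => u y ^ 2 * logWeight y / (y ^ 3 * (1 + y ^ 4))) (Ioi 0) :=
    integrableOn_Ioi_zero_of_le
      (by fun_prop (disch := intro y hy; have : 0 < y := hy; positivity))
      (fun y hy => by have := rpos y; positivity) (hT0.const_mul 2)
      fun y hy => sq_mul_logWeight_div_le hy (by positivity) (by ring)
  have hV : IntegrableOn (fun y => v y ^ 2 * logWeight y / (y * (1 + y ^ 4))) (Ioi 0) :=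
    integrableOn_Ioi_zero_of_le
      (by fun_prop (disch := intro y hy; have : 0 < y := hy; positivity))
      (fun y hy => by have := rpos y; positivity) (hV0.const_mul 2)
      fun y hy => sq_mul_logWeight_div_le hy (by positivity) (by ring)
  have hE : IntegrableOn (fun y => u y ^ 2 * logWeight y / (y ^ 3 * (1 + y ^ 4) ^ 2)) (Ioi 0) :=
    integrableOn_Ioi_zero_of_le
      (by fun_prop (disch := intro y hy; have : 0 < y := hy; positivity))
      (fun y hy => by have := rpos y; positivity) hT
      fun y hy => sq_mul_logWeight_div_sq_le (u y) hy
  have hL1 := integrableOn_sq_div_one_add_pow_eight cv hV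
  have hL2 := integrableOn_sq_div_one_add_pow_ten cu hT
  have eL : (fun y => v y ^ 2 * y / (1 + y ^ 8) + u y ^ 2 * y / (1 + y ^ 10)) =
      fun y => v y ^ 2 / (1 + y ^ 8) * y + u y ^ 2 / (1 + y ^ 10) * y := by
    ext y; ring
  obtain ⟨hP, leP⟩ := integral_sub_div_id_le d1 d2 hF hA hE (integrableOn_sub_div_id cu cv hT hV)
  have leE := integral_cutoff_le (by norm_num) hM hc d1 hT hP (eL ▸ hL1.add hL2)
  rw [eL, integral_add hL1 hL2, integral_div] at leE
  have leT := integral_hardy_le d1 hT hE hP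
  rw [integral_div] at leT
  have leA0 := setIntegral_Ioi_zero_mono (fun y hy => by have := rpos y; positivity)
    (hA0.const_mul 2) leA
  rw [integral_const_mul] at leA0
  have i12 : IntegrableOn (fun y => 2 * (F y ^ 2 / (y ^ 4 * (1 + |log y|) ^ 2) * y) +
      2 * (F' y ^ 2 / (y ^ 2 * (1 + |log y|) ^ 2) * y)) (Ioi 0) :=
    (hA0.const_mul 2).add (hA1.const_mul 2)
  have i123 : IntegrableOn (fun y => 2 * (F y ^ 2 / (y ^ 4 * (1 + |log y|) ^ 2) * y) +
      2 * (F' y ^ 2 / (y ^ 2 * (1 + |log y|) ^ 2) * y) +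
      (v y - u y / y) ^ 2 * logWeight y / y ^ 5) (Ioi 0) := i12.add hP
  have iS : IntegrableOn (controlDensity u v F F') (Ioi 0) := i123.add hT
  have eS : ∫ y in Ioi 0, controlDensity u v F F' y =
      2 * (∫ y in Ioi 0, F y ^ 2 / (y ^ 4 * (1 + |log y|) ^ 2) * y) +
      2 * (∫ y in Ioi 0, F' y ^ 2 / (y ^ 2 * (1 + |log y|) ^ 2) * y) +
      (∫ y in Ioi 0, (v y - u y / y) ^ 2 * logWeight y / y ^ 5) +
      ∫ y in Ioi 0, u y ^ 2 * logWeight y / (y ^ 3 * (1 + y ^ 4)) := by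
    unfold controlDensity
    rw [integral_add i123 hT, integral_add i12 hP,
      integral_add (hA0.const_mul 2) (hA1.const_mul 2), integral_const_mul, integral_const_mul]
  have bound : ∀ f : ℝ → ℝ, (∀ y > 0, 0 ≤ f y) →
      (∀ y > 0, f y ≤ 11000 * controlDensity u v F F' y) →
      ∫ y in Ioi 0, f y ≤ 11000 * ∫ y in Ioi 0, controlDensity u v F F' y := fun f f0 hf =>
    (setIntegral_Ioi_zero_mono f0 (iS.const_mul 11000) hf).trans_eq (integral_const_mul _ _)
  have key := fun y (hy : 0 < y) => controlDensity_bounds hy (hF y hy) (hF' y hy)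
  have b0 := bound _ (fun y hy => by positivity) fun y hy => (key y hy).1
  have b1 := bound _ (fun y hy => by positivity) fun y hy => (key y hy).2.1
  have b2 := bound _ (fun y hy => by positivity) fun y hy => (key y hy).2.2.1
  have b3 := bound _ (fun y hy => by positivity) fun y hy => (key y hy).2.2.2
  have nA0 : 0 ≤ ∫ y in Ioi (0 : ℝ), F y ^ 2 / (y ^ 4 * (1 + |log y|) ^ 2) * y :=
    setIntegral_nonneg measurableSet_Ioi fun y (hy : 0 < y) => by positivity
  have nA1 : 0 ≤ ∫ y in Ioi (0 : ℝ), F' y ^ 2 / (y ^ 2 * (1 + |log y|) ^ 2) * y :=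
    setIntegral_nonneg measurableSet_Ioi fun y (hy : 0 < y) => by positivity
  have nL1 : 0 ≤ ∫ y in Ioi (0 : ℝ), v y ^ 2 / (1 + y ^ 8) * y :=
    setIntegral_nonneg measurableSet_Ioi fun y (hy : 0 < y) => by positivity
  have nL2 : 0 ≤ ∫ y in Ioi (0 : ℝ), u y ^ 2 / (1 + y ^ 10) * y :=
    setIntegral_nonneg measurableSet_Ioi fun y (hy : 0 < y) => by positivity
  have nL : 0 ≤ (4 * M + 64) * ((∫ y in Ioi (0 : ℝ), v y ^ 2 / (1 + y ^ 8) * y) +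
      ∫ y in Ioi (0 : ℝ), u y ^ 2 / (1 + y ^ 10) * y) := by positivity
  rw [mul_assoc 100]
  linarith

/-- Weighted sub-coercivity for `H`: there exist universal `c, C > 0` such that for every
`u ∈ C³((0,∞))` with the stated finiteness assumptions,
`∫ (Hu)²/(y⁴(1+|log y|)²) + ∫ ((Hu)')²/(y²(1+|log y|)²)
  ≥ c [∫ u²/(y⁴(1+y⁴)(1+|log y|)²) + ∫ (u')²/(y²(1+y⁴)(1+|log y|)²)
      + ∫ (u'')²/(y⁴(1+|log y|)²) + ∫ (u''')²/(y²(1+|log y|)²)]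
    − C [∫ (u')²/(1+y⁸) + ∫ u²/(1+y¹⁰)]` (all with respect to `y dy`). -/
theorem weighted_subcoercivity_H :
    ∃ c C : ℝ, 0 < c ∧ 0 < C ∧
      ∀ u : ℝ → ℝ, ContDiffOn ℝ 3 u (Set.Ioi 0) →
        IntegrableOn (fun y => (Hop u y) ^ 2 / (y ^ 4 * (1 + |Real.log y|) ^ 2) * y)
          (Set.Ioi 0) →
        IntegrableOn
          (fun y => (deriv (Hop u) y) ^ 2 / (y ^ 2 * (1 + |Real.log y|) ^ 2) * y)
          (Set.Ioi 0) →
        IntegrableOn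
          (fun y => (u y) ^ 2 / (y ^ 4 * (1 + y ^ 4) * (1 + |Real.log y|) ^ 2) * y)
          (Set.Ioi 0) →
        IntegrableOn
          (fun y => (deriv u y) ^ 2 / (y ^ 2 * (1 + y ^ 4) * (1 + |Real.log y|) ^ 2) * y)
          (Set.Ioi 0) →
        (∫ y in Set.Ioi (0:ℝ), (Hop u y) ^ 2 / (y ^ 4 * (1 + |Real.log y|) ^ 2) * y)
            + (∫ y in Set.Ioi (0:ℝ),
                (deriv (Hop u) y) ^ 2 / (y ^ 2 * (1 + |Real.log y|) ^ 2) * y)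
          ≥ c * ((∫ y in Set.Ioi (0:ℝ),
                  (u y) ^ 2 / (y ^ 4 * (1 + y ^ 4) * (1 + |Real.log y|) ^ 2) * y)
              + (∫ y in Set.Ioi (0:ℝ),
                  (deriv u y) ^ 2 / (y ^ 2 * (1 + y ^ 4) * (1 + |Real.log y|) ^ 2) * y)
              + (∫ y in Set.Ioi (0:ℝ),
                  (deriv (deriv u) y) ^ 2 / (y ^ 4 * (1 + |Real.log y|) ^ 2) * y)
              + ∫ y in Set.Ioi (0:ℝ),
                  (deriv (deriv (deriv u)) y) ^ 2 / (y ^ 2 * (1 + |Real.log y|) ^ 2) * y)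
            - C * ((∫ y in Set.Ioi (0:ℝ), (deriv u y) ^ 2 / (1 + y ^ 8) * y)
              + ∫ y in Set.Ioi (0:ℝ), (u y) ^ 2 / (1 + y ^ 10) * y) := by
  obtain ⟨c, C, hc, hC, h⟩ := exists_subcoercivity_constants
  refine ⟨c, C, hc, hC, ?_⟩
  intro u hu hA0 hA1 hT0 hV0
  have hu' : ContDiffOn ℝ 2 (deriv u) (Ioi 0) := hu.deriv_of_isOpen isOpen_Ioi (by norm_num)
  have hu'' : ContDiffOn ℝ 1 (deriv (deriv u)) (Ioi 0) :=
    hu'.deriv_of_isOpen isOpen_Ioi (by norm_num)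
  have d1 : ∀ y > 0, HasDerivAt u (deriv u y) y := fun y hy =>
    ((hu.contDiffAt (Ioi_mem_nhds hy)).differentiableAt (by norm_num)).hasDerivAt
  have d2 : ∀ y > 0, HasDerivAt (deriv u) (deriv (deriv u) y) y := fun y hy =>
    ((hu'.contDiffAt (Ioi_mem_nhds hy)).differentiableAt (by norm_num)).hasDerivAt
  have d3 : ∀ y > 0, HasDerivAt (deriv (deriv u)) (deriv (deriv (deriv u)) y) y := fun y hy =>
    ((hu''.contDiffAt (Ioi_mem_nhds hy)).differentiableAt (by norm_num)).hasDerivAt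
  have cF : ContinuousOn (Hop u) (Ioi 0) := by
    have c1 := continuousOn_Ioi_zero_of_hasDerivAt d1
    have c2 := continuousOn_Ioi_zero_of_hasDerivAt d2
    have c3 := continuousOn_Ioi_zero_of_hasDerivAt d3
    unfold Hop Vfun
    fun_prop (disch := intro y hy; have : 0 < y := hy; positivity)
  exact h u _ _ _ _ _ d1 d2 cF (fun y hy => Hop_add_potential u hy)
    (fun y hy => deriv_Hop_add rfl rfl d1 d2 d3 hy) hA0 hA1 hT0 hV0
end
end
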